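/- Let A be an m×n matrix of linear forms over S with m ≤ n. If A is column-graded, then I_2(A) has a universal Gröbner basis consisting of Z^n-homogeneous elements of multidegree componentwise at most e_1+...+e_n = (1,...,1) ∈ Z^n. If A is row-graded, then I_2(A) has a universal Gröbner basis consisting of Z^m-homogeneous elements of multidegree componentwise at most e_1+...+e_m = (1,...,1) ∈ Z^m. -/

import Mathlib

open MvPolynomial

noncomputable section

namespace CSPaper

/-- The set of variables of the standard `ℤ^v`-graded polynomial ring `S`:
the variable `x_{i j}` of the paper (with `1 ≤ i ≤ v`, `1 ≤ j ≤ n_i`) corresponds to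
`⟨i-1, j-1⟩ : MVar v n` where `n (i-1) = n_i - 1`; thus row `i` has `n i + 1 > 0`
variables and the first variable `x_{i 1}` of row `i` corresponds to `⟨i, 0⟩`. -/
abbrev MVar (v : ℕ) (n : Fin v → ℕ) : Type := Σ i : Fin v, Fin (n i + 1)

/-- The weight function giving the standard `ℤ^v`-grading: `deg (x_{i j}) = e_i ∈ ℤ^v`. -/
def wt (v : ℕ) (n : Fin v → ℕ) : MVar v n → (Fin v → ℕ) := fun p => Pi.single p.1 1

variable {K : Type} [Field K] {v : ℕ} {n : Fin v → ℕ}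

/-- An ideal of `S` is `ℤ^v`-graded (multigraded) iff it contains every multihomogeneous
component of each of its elements. -/
def IsMultigraded (I : Ideal (MvPolynomial (MVar v n) K)) : Prop :=
  ∀ f ∈ I, ∀ a : Fin v → ℕ, weightedHomogeneousComponent (wt v n) a f ∈ I

/-- The value of the `ℤ^v`-graded Hilbert function of the ideal `I` at `a ∈ ℕ^v`:
`dim_K I_a`. -/
def hilb (I : Ideal (MvPolynomial (MVar v n) K)) (a : Fin v → ℕ) : ℕ :=
  Module.finrank K
    ((Submodule.restrictScalars K I ⊓ weightedHomogeneousSubmodule K (wt v n) a :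
      Submodule K (MvPolynomial (MVar v n) K)))

/-- Two ideals have the same `ℤ^v`-graded Hilbert series. -/
def sameHS (I J : Ideal (MvPolynomial (MVar v n) K)) : Prop :=
  ∀ a : Fin v → ℕ, hilb I a = hilb J a

/-- The `ℤ^v`-graded `K`-algebra endomorphism of `S` determined by a `v`-tuple of square
matrices: `x_{i j} ↦ ∑_k (g i)_{k j} x_{i k}`.  For invertible `g i` these are exactly the
elements of `G = GL_{n_1}(K) × ⋯ × GL_{n_v}(K)` acting on `S`. -/
def gAct (g : ∀ i : Fin v, Matrix (Fin (n i + 1)) (Fin (n i + 1)) K) :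
    MvPolynomial (MVar v n) K →ₐ[K] MvPolynomial (MVar v n) K :=
  aeval fun p : MVar v n => ∑ k : Fin (n p.1 + 1), C (g p.1 k p.2) * X ⟨p.1, k⟩

/-- A property `P` of `v`-tuples of matrices holds generically (i.e. for a general
`g ∈ GL_{n_1}(K) × ⋯ × GL_{n_v}(K)`) if there is a nonzero polynomial `h` in the matrix
entries such that `P g` holds for every invertible `g` with `h(g) ≠ 0`. -/
def Generically
    (P : (∀ i : Fin v, Matrix (Fin (n i + 1)) (Fin (n i + 1)) K) → Prop) : Prop :=
  ∃ h : MvPolynomial (Σ i : Fin v, Fin (n i + 1) × Fin (n i + 1)) K, h ≠ 0 ∧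
    ∀ g : ∀ i : Fin v, Matrix (Fin (n i + 1)) (Fin (n i + 1)) K,
      (∀ i, IsUnit (g i).det) →
      eval (fun q : Σ i : Fin v, Fin (n i + 1) × Fin (n i + 1) => g q.1 q.2.1 q.2.2) h ≠ 0 →
      P g

/-- The leading exponent (exponent of the leading monomial) of a polynomial with respect to
a term order `τ` (a `MonomialOrder`); by convention `leadExp τ 0 = 0`. -/
def leadExp (τ : MonomialOrder (MVar v n)) (f : MvPolynomial (MVar v n) K) :
    MVar v n →₀ ℕ :=
  τ.toSyn.symm (f.support.sup τ.toSyn)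

/-- The initial ideal `in_τ(I)`: the monomial ideal generated by the leading monomials of the
nonzero elements of `I`. -/
def inIdeal (τ : MonomialOrder (MVar v n)) (I : Ideal (MvPolynomial (MVar v n) K)) :
    Ideal (MvPolynomial (MVar v n) K) :=
  Ideal.span {m | ∃ f ∈ I, f ≠ 0 ∧ m = monomial (leadExp τ f) (1 : K)}

/-- `G` is a Gröbner basis of `I` with respect to the term order `τ`. -/
def IsGroebnerBasis (τ : MonomialOrder (MVar v n)) (G : Set (MvPolynomial (MVar v n) K))
    (I : Ideal (MvPolynomial (MVar v n) K)) : Prop :=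
  G ⊆ (I : Set (MvPolynomial (MVar v n) K)) ∧
    Ideal.span ((fun f => monomial (leadExp τ f) (1 : K)) '' {f ∈ G | f ≠ 0}) = inIdeal τ I

/-- `J = gin_τ(I)`, the `ℤ^v`-graded generic initial ideal: for a general
`g ∈ GL_{n_1}(K) × ⋯ × GL_{n_v}(K)` one has `in_τ(g(I)) = J`. -/
def IsGin (τ : MonomialOrder (MVar v n)) (I J : Ideal (MvPolynomial (MVar v n) K)) : Prop :=
  Generically fun g => inIdeal τ (Ideal.map (gAct g) I) = J

/-- A term order such that `x_{i j} > x_{i k}` whenever `j < k`. -/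
def RespectsVarOrder (τ : MonomialOrder (MVar v n)) : Prop :=
  ∀ (i : Fin v) (j k : Fin (n i + 1)), j < k →
    τ.toSyn (Finsupp.single (⟨i, k⟩ : MVar v n) 1) <
      τ.toSyn (Finsupp.single (⟨i, j⟩ : MVar v n) 1)

/-- An ideal is Borel fixed if it is fixed by every element of the Borel subgroup
`B = B_{n_1}(K) × ⋯ × B_{n_v}(K)` of upper triangular invertible matrices (upper triangular
with respect to the order `x_{i 1} > x_{i 2} > ⋯` of the variables in each row). -/
def BorelFixed (I : Ideal (MvPolynomial (MVar v n) K)) : Prop :=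
  ∀ g : ∀ i : Fin v, Matrix (Fin (n i + 1)) (Fin (n i + 1)) K,
    (∀ i, IsUnit (g i).det) →
    (∀ (i : Fin v) (k j : Fin (n i + 1)), j < k → g i k j = 0) →
    Ideal.map (gAct g) I = I

/-- A Cartwright-Sturmfels ideal: a `ℤ^v`-graded ideal with the same `ℤ^v`-graded Hilbert
series as some radical Borel fixed ideal. -/
def IsCS (I : Ideal (MvPolynomial (MVar v n) K)) : Prop :=
  IsMultigraded I ∧ ∃ J : Ideal (MvPolynomial (MVar v n) K),
    J.IsRadical ∧ BorelFixed J ∧ sameHS I J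

/-- The exponent of the monomial `x_{1 1}^{a 1} ⋯ x_{v 1}^{a v}` of
`T = K[x_{1 1}, …, x_{v 1}] ⊆ S`. -/
def Tmono (v : ℕ) (n : Fin v → ℕ) (a : Fin v → ℕ) : MVar v n →₀ ℕ :=
  ∑ i : Fin v, Finsupp.single (⟨i, 0⟩ : MVar v n) (a i)

/-- A `ℤ^v`-graded ideal of `S` extended from `T`, i.e. generated by monomials in the
variables `x_{1 1}, …, x_{v 1}`. -/
def ExtendedFromT (J : Ideal (MvPolynomial (MVar v n) K)) : Prop :=
  ∃ A : Set (Fin v → ℕ),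
    J = Ideal.span ((fun a => monomial (Tmono v n a) (1 : K)) '' A)

/-- A Cartwright-Sturmfels* ideal: a `ℤ^v`-graded ideal with the same `ℤ^v`-graded Hilbert
series as some ideal extended from `T`. -/
def IsCSstar (J : Ideal (MvPolynomial (MVar v n) K)) : Prop :=
  IsMultigraded J ∧ ∃ C : Ideal (MvPolynomial (MVar v n) K), ExtendedFromT C ∧ sameHS J C

/-- A monomial ideal. -/
def IsMonomialIdeal (I : Ideal (MvPolynomial (MVar v n) K)) : Prop :=
  ∃ A : Set (MVar v n →₀ ℕ), I = Ideal.span ((fun s => monomial s (1 : K)) '' A)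

/-- A squarefree monomial ideal. -/
def IsSqfreeMonomialIdeal (I : Ideal (MvPolynomial (MVar v n) K)) : Prop :=
  ∃ A : Set (MVar v n →₀ ℕ), (∀ s ∈ A, ∀ x, s x ≤ 1) ∧
    I = Ideal.span ((fun s => monomial s (1 : K)) '' A)

/-- `J` is the Alexander dual of the squarefree monomial ideal `I`: `J` is generated by the
products `∏_{x ∈ P} x` as `P` ranges over the minimal primes of `I`. -/
def IsAlexanderDual (I J : Ideal (MvPolynomial (MVar v n) K)) : Prop :=
  J = Ideal.span {m | ∃ F : Finset (MVar v n),
    Ideal.span ((fun x => (X x : MvPolynomial (MVar v n) K)) '' ↑F) ∈ I.minimalPrimes ∧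
    m = ∏ x ∈ F, X x}

/-- The sequence `x_{i j} - λ_{i j} x_{i 1}`, `1 ≤ i ≤ v`, `2 ≤ j ≤ n_i`, as a list. -/
def LamList (lam : MVar v n → K) : List (MvPolynomial (MVar v n) K) :=
  (List.finRange v).flatMap fun i =>
    ((List.finRange (n i + 1)).drop 1).map fun j =>
      X (⟨i, j⟩ : MVar v n) - C (lam ⟨i, j⟩) * X (⟨i, 0⟩ : MVar v n)

/-- A property of the scalars `λ = (λ_{i j})` holds for general `λ ∈ K^N` if there is a
nonzero polynomial `h` in the `λ_{i j}` such that the property holds whenever `h(λ) ≠ 0`. -/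
def GenericallyLam {v : ℕ} {n : Fin v → ℕ} (K : Type) [Field K]
    (P : (MVar v n → K) → Prop) : Prop :=
  ∃ h : MvPolynomial (MVar v n) K, h ≠ 0 ∧
    ∀ lam : MVar v n → K, eval lam h ≠ 0 → P lam

variable {K : Type} [Field K] {v : ℕ} {n : Fin v → ℕ}

/-- A graded free resolution of an ideal `I` of a polynomial ring graded by an additive
monoid `M` via a weight function `w` on the variables:
`⋯ → F_2 → F_1 → F_0 → I → 0`, where `F_p` is the free module with (finite) basis `ι p`,
the basis element `i : ι p` having degree `deg p i ∈ M`, all maps are graded of degree `0`,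
and the complex is exact. -/
structure GradedFreeResolution (σ : Type) (K : Type) [Field K] (M : Type) [AddCommMonoid M]
    (w : σ → M) (I : Ideal (MvPolynomial σ K)) where
  ι : ℕ → Type
  finite : ∀ p, Finite (ι p)
  deg : ∀ p, ι p → M
  aug : (ι 0 →₀ MvPolynomial σ K) →ₗ[MvPolynomial σ K] MvPolynomial σ K
  d : ∀ p, (ι (p + 1) →₀ MvPolynomial σ K) →ₗ[MvPolynomial σ K] (ι p →₀ MvPolynomial σ K)
  aug_graded : ∀ i : ι 0, (aug (Finsupp.single i 1)).IsWeightedHomogeneous w (deg 0 i)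
  d_graded : ∀ (p : ℕ) (i : ι (p + 1)) (j : ι p),
    (d p (Finsupp.single i 1)) j = 0 ∨
      ∃ b, ((d p (Finsupp.single i 1)) j).IsWeightedHomogeneous w b ∧
        b + deg p j = deg (p + 1) i
  range_aug : LinearMap.range aug = (I : Submodule (MvPolynomial σ K) (MvPolynomial σ K))
  exact_zero : LinearMap.ker aug = LinearMap.range (d 0)
  exact : ∀ p, LinearMap.ker (d p) = LinearMap.range (d (p + 1))

/-- A graded free resolution is minimal if all entries of the matrices of the differentials
between free modules lie in the irrelevant maximal ideal, i.e. have zero constant term. -/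
def GradedFreeResolution.Minimal {σ M : Type} [AddCommMonoid M] {w : σ → M}
    {I : Ideal (MvPolynomial σ K)} (F : GradedFreeResolution σ K M w I) : Prop :=
  ∀ (p : ℕ) (i : F.ι (p + 1)) (j : F.ι p),
    MvPolynomial.constantCoeff ((F.d p (Finsupp.single i 1)) j) = 0

/-- The graded Betti number `β_{p,a}` read off from a (minimal) graded free resolution:
the number of basis elements of `F_p` of degree `a`. -/
def GradedFreeResolution.betti {σ M : Type} [AddCommMonoid M] {w : σ → M}
    {I : Ideal (MvPolynomial σ K)} (F : GradedFreeResolution σ K M w I) (p : ℕ) (a : M) :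
    ℕ :=
  Nat.card {i : F.ι p // F.deg p i = a}

/-- The set of `t × t` minors of the matrix `A`. -/
def minorsSet {R : Type} [CommRing R] (t : ℕ) {m N : ℕ} (A : Matrix (Fin m) (Fin N) R) :
    Set R :=
  {d | ∃ (r : Fin t → Fin m) (c : Fin t → Fin N),
    Function.Injective r ∧ Function.Injective c ∧ d = (A.submatrix r c).det}

/-- `I_t(A)`, the ideal generated by the `t × t` minors of `A`. -/
def minorsIdeal {R : Type} [CommRing R] (t : ℕ) {m N : ℕ}
    (A : Matrix (Fin m) (Fin N) R) : Ideal R :=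
  Ideal.span (minorsSet t A)

/-- `A` is column-graded: `N ≤ v` and each entry of the `j`-th column is either `0` or
multihomogeneous of degree `e_j ∈ ℤ^v`. -/
def ColumnGraded {m N : ℕ} (A : Matrix (Fin m) (Fin N) (MvPolynomial (MVar v n) K)) :
    Prop :=
  ∃ h : N ≤ v, ∀ i j, A i j = 0 ∨
    (A i j).IsWeightedHomogeneous (wt v n) (Pi.single (Fin.castLE h j) 1)

/-- `A` is row-graded: `m ≤ v` and each entry of the `i`-th row is either `0` or
multihomogeneous of degree `e_i ∈ ℤ^v`. -/
def RowGraded {m N : ℕ} (A : Matrix (Fin m) (Fin N) (MvPolynomial (MVar v n) K)) : Prop :=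
  ∃ h : m ≤ v, ∀ i j, A i j = 0 ∨
    (A i j).IsWeightedHomogeneous (wt v n) (Pi.single (Fin.castLE h i) 1)

/-- The exponent of the polarization of the monomial `x_{1 1}^{a 1} ⋯ x_{v 1}^{a v}` of `T`:
the squarefree monomial `∏_i x_{i 1} x_{i 2} ⋯ x_{i (a i)}`. -/
def polExp (v : ℕ) (n : Fin v → ℕ) (a : Fin v → ℕ) : MVar v n →₀ ℕ :=
  ∑ i : Fin v, ∑ j ∈ Finset.univ.filter (fun j : Fin (n i + 1) => (j : ℕ) < a i),
    Finsupp.single (⟨i, j⟩ : MVar v n) 1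

/-- `P = pol(C)`, the polarization of an ideal `C` extended from `T`
(the exponents of the generators of `C` must fit inside `S`). -/
def IsPolarizationOfT (C P : Ideal (MvPolynomial (MVar v n) K)) : Prop :=
  ∃ A : Set (Fin v → ℕ), (∀ a ∈ A, ∀ i, a i ≤ n i + 1) ∧
    C = Ideal.span ((fun a => monomial (Tmono v n a) (1 : K)) '' A) ∧
    P = Ideal.span ((fun a => monomial (polExp v n a) (1 : K)) '' A)

/-- `ψ` is an identification of the quotient of `S` by the `ℤ^v`-graded ideal `Q` with a
standard `ℤ^v`-graded polynomial ring, compatible with the gradings. -/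
def IsGradedStructureIso {n₂ : Fin v → ℕ} (Q : Ideal (MvPolynomial (MVar v n) K))
    (ψ : (MvPolynomial (MVar v n) K ⧸ Q) ≃ₐ[K] MvPolynomial (MVar v n₂) K) : Prop :=
  ∀ (f : MvPolynomial (MVar v n) K) (a : Fin v → ℕ),
    f.IsWeightedHomogeneous (wt v n) a →
      (ψ (Ideal.Quotient.mk Q f)).IsWeightedHomogeneous (wt v n₂) a

end CSPaper

open CSPaper

/-- All coefficients of `x` at exponents below `a` vanish. -/
def VanishesBelow {Γ : Type*} {K : Type} [PartialOrder Γ] [Zero K] (x : HahnSeries Γ K) (a : Γ) :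
    Prop :=
  ∀ g < a, x.coeff g = 0

namespace VanishesBelow

section Additive

variable {Γ : Type*} {K : Type} [LinearOrder Γ] [Field K]

theorem zero (a : Γ) : VanishesBelow (0 : HahnSeries Γ K) a := fun _ _ => rfl

theorem add {x y : HahnSeries Γ K} {a : Γ} (hx : VanishesBelow x a) (hy : VanishesBelow y a) :
    VanishesBelow (x + y) a := fun g hg => by
  rw [HahnSeries.coeff_add, hx g hg, hy g hg, add_zero]

theorem smul {x : HahnSeries Γ K} {a : Γ} (c : K) (hx : VanishesBelow x a) :
    VanishesBelow (c • x) a := fun g hg => by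
  rw [HahnSeries.coeff_smul, hx g hg, smul_zero]

theorem mono {x : HahnSeries Γ K} {a b : Γ} (hx : VanishesBelow x a) (h : b ≤ a) :
    VanishesBelow x b := fun g hg => hx g (hg.trans_le h)

theorem le_of_coeff_ne_zero {x : HahnSeries Γ K} {a g : Γ} (hx : VanishesBelow x a)
    (hg : x.coeff g ≠ 0) : a ≤ g := by
  by_contra h
  exact hg (hx g (not_le.mp h))

theorem single (s : Γ) : VanishesBelow (HahnSeries.single s (1 : K)) s := fun g hg => by
  rw [HahnSeries.coeff_single_of_ne hg.ne]

theorem one [Zero Γ] : VanishesBelow (1 : HahnSeries Γ K) 0 := fun g hg => by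
  rw [HahnSeries.coeff_one, if_neg hg.ne]

end Additive

section Multiplicative

variable {Γ : Type*} {K : Type} [AddCommGroup Γ] [LinearOrder Γ] [IsOrderedAddMonoid Γ] [Field K]

theorem coeff_mul {x y : HahnSeries Γ K} {a b : Γ} (hx : VanishesBelow x a)
    (hy : VanishesBelow y b) : (x * y).coeff (a + b) = x.coeff a * y.coeff b := by
  rw [HahnSeries.coeff_mul]
  have key : ∀ p : Γ × Γ, p.1 + p.2 = a + b → x.coeff p.1 ≠ 0 → y.coeff p.2 ≠ 0 →
      p = (a, b) := by
    rintro ⟨p, q⟩ h h1 h2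
    have h3 := hx.le_of_coeff_ne_zero h1
    have h4 := hy.le_of_coeff_ne_zero h2
    simp only at h h3 h4
    have h5 : p = a := by
      by_contra hne
      exact absurd h (add_lt_add_of_lt_of_le (lt_of_le_of_ne h3 (Ne.symm hne)) h4).ne'
    subst h5
    simpa using h
  by_cases hab : x.coeff a ≠ 0 ∧ y.coeff b ≠ 0
  · rw [Finset.sum_eq_single (a, b)]
    · rintro p hp hne
      rw [Finset.mem_antidiagonal] at hp
      exact absurd (key p hp.2.2 hp.1 hp.2.1) hne
    · intro h
      refine absurd ?_ h
      rw [Finset.mem_antidiagonal]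
      exact ⟨hab.1, hab.2, rfl⟩
  · have h0 : x.coeff a * y.coeff b = 0 := by
      by_contra h
      exact hab ⟨left_ne_zero_of_mul h, right_ne_zero_of_mul h⟩
    rw [h0]
    refine Finset.sum_eq_zero fun p hp => ?_
    rw [Finset.mem_antidiagonal] at hp
    rw [key p hp.2.2 hp.1 hp.2.1, h0]

theorem mul {x y : HahnSeries Γ K} {a b : Γ} (hx : VanishesBelow x a)
    (hy : VanishesBelow y b) : VanishesBelow (x * y) (a + b) := fun g hg => by
  rw [HahnSeries.coeff_mul]
  refine Finset.sum_eq_zero fun p hp => ?_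
  rw [Finset.mem_antidiagonal] at hp
  exact absurd (hp.2.2 ▸ add_le_add (hx.le_of_coeff_ne_zero hp.1)
    (hy.le_of_coeff_ne_zero hp.2.1)) (not_le.mpr hg)

theorem prod {ι : Type} (s : Finset ι) {x : ι → HahnSeries Γ K} {a : ι → Γ}
    (h : ∀ i ∈ s, VanishesBelow (x i) (a i)) :
    VanishesBelow (∏ i ∈ s, x i) (∑ i ∈ s, a i) ∧
      (∏ i ∈ s, x i).coeff (∑ i ∈ s, a i) = ∏ i ∈ s, (x i).coeff (a i) := by
  classical
  induction s using Finset.induction_on with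
  | empty => exact ⟨by simpa using one, by simp⟩
  | insert i s hi ih =>
    obtain ⟨h1, h2⟩ := ih fun j hj => h j (Finset.mem_insert_of_mem hj)
    have h3 := h i (Finset.mem_insert_self i s)
    rw [Finset.prod_insert hi, Finset.sum_insert hi, Finset.prod_insert hi]
    exact ⟨h3.mul h1, by rw [h3.coeff_mul h1, h2]⟩

theorem pow {x : HahnSeries Γ K} {a : Γ} (h : VanishesBelow x a) (n : ℕ) :
    VanishesBelow (x ^ n) (n • a) ∧ (x ^ n).coeff (n • a) = x.coeff a ^ n := by
  simpa using prod (Finset.range n) (x := fun _ => x) (a := fun _ => a) fun _ _ => h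

theorem single_mul {x : HahnSeries Γ K} {a : Γ} (s : Γ) (h : VanishesBelow x a) :
    VanishesBelow (HahnSeries.single s (1 : K) * x) (s + a) := (single s).mul h

theorem coeff_single_mul {x : HahnSeries Γ K} {a : Γ} (s : Γ) (h : VanishesBelow x a) :
    (HahnSeries.single s (1 : K) * x).coeff (s + a) = x.coeff a := by
  rw [(single s).coeff_mul h, HahnSeries.coeff_single_same, one_mul]

end Multiplicative

end VanishesBelow

/-- Evaluating a function with lead `x₀` at a tropically bounded point attaining the bound at `x₀`
gives a nonzero coefficient. -/
theorem coeff_sum_smul_ne_zero {Γ : Type*} {K X : Type} [AddCommGroup Γ] [LinearOrder Γ]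
    [IsOrderedAddMonoid Γ] [Field K] (s : Finset X) (κ : X → Γ) (P : X → HahnSeries Γ K)
    (N : Γ) (hP : ∀ x ∈ s, VanishesBelow (P x) (N - κ x)) (x₀ : X) (hx₀ : x₀ ∈ s)
    (hP₀ : (P x₀).coeff (N - κ x₀) ≠ 0) (g : X → K) (hg₀ : g x₀ ≠ 0)
    (hg : ∀ x ∈ s, x ≠ x₀ → g x = 0 ∨ κ x < κ x₀) :
    (∑ x ∈ s, g x • P x).coeff (N - κ x₀) ≠ 0 := by
  rw [HahnSeries.coeff_sum, Finset.sum_eq_single x₀]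
  · rw [HahnSeries.coeff_smul, smul_eq_mul]
    exact mul_ne_zero hg₀ hP₀
  · intro x hx hne
    rw [HahnSeries.coeff_smul]
    rcases hg x hx hne with h | h
    · rw [h, zero_smul]
    · rw [hP x hx _ (sub_lt_sub_left h N), smul_zero]
  · exact fun h => absurd hx₀ h

/-- The set of leading indices, with respect to the weight `κ`, of the nonzero elements of a space
of functions. -/
def leads {Γ : Type*} {K X : Type} [LinearOrder Γ] [Field K] (κ : X → Γ)
    (G : Submodule K (X → K)) : Set X :=
  {x | ∃ g ∈ G, g x ≠ 0 ∧ ∀ y, κ x < κ y → g y = 0}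

theorem finrank_le_card_leads {Γ : Type*} {K X : Type} [LinearOrder Γ] [Field K] [Fintype X]
    (κ : X → Γ) (G : Submodule K (X → K)) : Module.finrank K G ≤ Nat.card (leads κ G) := by
  classical
  let φ : G →ₗ[K] (leads κ G → K) :=
    (LinearMap.funLeft K K (Subtype.val : leads κ G → X)).comp G.subtype
  have hφ : Function.Injective φ := by
    rw [injective_iff_map_eq_zero]
    rintro ⟨g, hg⟩ h
    by_contra hne
    have hne' : (Finset.univ.filter fun x => g x ≠ 0).Nonempty := by
      by_contra hemp
      rw [Finset.not_nonempty_iff_eq_empty, Finset.filter_eq_empty_iff] at hemp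
      exact hne (Subtype.ext (funext fun x => not_not.mp (hemp (Finset.mem_univ x))))
    obtain ⟨x, hx, hmax⟩ := Finset.exists_max_image _ κ hne'
    have hx' : g x ≠ 0 := (Finset.mem_filter.mp hx).2
    have hlead : x ∈ leads κ G := ⟨g, hg, hx', fun y hy => by
      by_contra hgy
      exact absurd (hmax y (Finset.mem_filter.mpr ⟨Finset.mem_univ y, hgy⟩)) (not_le.mpr hy)⟩
    exact hx' (congrFun h ⟨x, hlead⟩)
  have := LinearMap.finrank_le_finrank_of_injective hφ
  rwa [Module.finrank_fintype_fun_eq_card, ← Nat.card_eq_fintype_card] at this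

/-- The linear form `y_i + ∑ q, a i j q * x_q` in the variables `y` and `x` of block `j`. -/
def blockForm {K ι : Type} [Field K] {E : ι → Type} {m : ℕ} (a : Fin m → ∀ j, E j → K)
    (i : Fin m) (j : ι) : Fin m ⊕ E j → K :=
  Sum.elim (Pi.single i 1) (a i j)

/-- The point whose `x`-coordinates in block `j` are `v j` and at which all forms
`blockForm a i j` take the value `w i`. -/
def blockPoint {K ι : Type} {L : Type*} [Field K] [AddCommGroup L] [Module K L] {E : ι → Type}
    [∀ j, Fintype (E j)] {m : ℕ}
    (a : Fin m → ∀ j, E j → K) (w : Fin m → L) (v : ∀ j, E j → L) (j : ι) : Fin m ⊕ E j → L :=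
  Sum.elim (fun i => w i - ∑ q, a i j q • v j q) (v j)

section BlockPoint

variable {K ι : Type} {L : Type*} [Field K] {E : ι → Type} [∀ j, Fintype (E j)] {m : ℕ}
  (a : Fin m → ∀ j, E j → K)

theorem sum_blockForm_smul_blockPoint [AddCommGroup L] [Module K L] (w : Fin m → L)
    (v : ∀ j, E j → L) (i : Fin m) (j : ι) :
    ∑ c, blockForm a i j c • blockPoint a w v j c = w i := by
  simp only [Fintype.sum_sum_type, blockForm, blockPoint, Sum.elim_inl, Sum.elim_inr]
  rw [Finset.sum_eq_single i (fun b _ hb => by rw [Pi.single_eq_of_ne hb, zero_smul])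
    (fun h => absurd (Finset.mem_univ i) h)]
  simp

theorem blockPoint_add [AddCommGroup L] [Module K L] (w w' : Fin m → L) (v v' : ∀ j, E j → L)
    (j : ι) (c : Fin m ⊕ E j) :
    blockPoint a (w + w') (v + v') j c = blockPoint a w v j c + blockPoint a w' v' j c := by
  cases c with
  | inl i =>
    simp only [blockPoint, Sum.elim_inl, Pi.add_apply, smul_add, Finset.sum_add_distrib]
    abel
  | inr q => rfl

theorem blockPoint_smul [AddCommGroup L] [Module K L] (r : K) (w : Fin m → L)
    (v : ∀ j, E j → L) (j : ι) (c : Fin m ⊕ E j) :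
    blockPoint a (r • w) (r • v) j c = r • blockPoint a w v j c := by
  cases c with
  | inl i =>
    simp only [blockPoint, Sum.elim_inl, Pi.smul_apply, smul_sub, Finset.smul_sum,
      smul_comm r]
  | inr q => rfl

theorem blockPoint_mul [CommRing L] [Algebra K L] (r : L) (w : Fin m → L)
    (v : ∀ j, E j → L) (j : ι) (c : Fin m ⊕ E j) :
    blockPoint a (fun i => r * w i) (fun j q => r * v j q) j c = r * blockPoint a w v j c := by
  cases c with
  | inl i =>
    simp only [blockPoint, Sum.elim_inl, mul_sub, Finset.mul_sum, Algebra.mul_smul_comm]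
  | inr q => rfl

end BlockPoint

/-- There is a point whose tropicalisation attains its bound, in each block `j`, at all indices
in `S j`. -/
def IsRealized {Γ : Type*} {K ι : Type} [AddCommGroup Γ] [LinearOrder Γ] [IsOrderedAddMonoid Γ]
    [Field K] {E : ι → Type} [∀ j, Fintype (E j)] {m : ℕ} (a : Fin m → ∀ j, E j → K)
    (γ : ∀ j, Fin m ⊕ E j → Γ) (S : ∀ j, Finset (Fin m ⊕ E j)) : Prop :=
  ∃ (w : Fin m → HahnSeries Γ K) (v : ∀ j, E j → HahnSeries Γ K) (ν : ι → Γ),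
    ∀ j c, VanishesBelow (blockPoint a w v j c) (ν j - γ j c) ∧
      (c ∈ S j → (blockPoint a w v j c).coeff (ν j - γ j c) ≠ 0)

section Merge

variable {Γ : Type*} {K ι : Type} [AddCommGroup Γ] [LinearOrder Γ] [IsOrderedAddMonoid Γ] [Field K]
  [Infinite K] [Fintype ι] {E : ι → Type} [∀ j, Fintype (E j)] {m : ℕ}
  {a : Fin m → ∀ j, E j → K} {γ : ∀ j, Fin m ⊕ E j → Γ}

theorem exists_generic_scalar {X : Type} [Finite X] (P Q : X → K) :
    ∃ θ : K, ∀ x, (P x ≠ 0 ∨ Q x ≠ 0) → P x + θ * Q x ≠ 0 := by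
  classical
  obtain ⟨θ, hθ⟩ := (Set.finite_range fun x => -P x / Q x).infinite_compl.nonempty
  refine ⟨θ, fun x hx h => ?_⟩
  by_cases hQ : Q x = 0
  · rw [hQ, mul_zero, add_zero] at h
    exact hx.elim (fun h' => h' h) (fun h' => h' hQ)
  · refine hθ ⟨x, ?_⟩
    simp only
    rw [div_eq_iff hQ]
    linear_combination -h

theorem IsRealized.union [DecidableEq ι] [∀ j, DecidableEq (E j)]
    {S : ∀ j, Finset (Fin m ⊕ E j)} (j₀ : ι)
    {D₁ D₂ : Finset (Fin m ⊕ E j₀)} (h₁ : IsRealized a γ (Function.update S j₀ D₁))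
    (h₂ : IsRealized a γ (Function.update S j₀ D₂)) :
    IsRealized a γ (Function.update S j₀ (D₁ ∪ D₂)) := by
  obtain ⟨w₁, v₁, ν₁, h₁⟩ := h₁
  obtain ⟨w₂, v₂, ν₂, h₂⟩ := h₂
  set s := ν₁ j₀ - ν₂ j₀ with hs
  set r : HahnSeries Γ K := HahnSeries.single s 1 with hr
  set w₃ : Fin m → HahnSeries Γ K := fun i => r * w₂ i with hw₃
  set v₃ : ∀ j, E j → HahnSeries Γ K := fun j q => r * v₂ j q with hv₃
  set ν₃ : ι → Γ := fun j => s + ν₂ j with hν₃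
  have h₃ : ∀ j c, VanishesBelow (blockPoint a w₃ v₃ j c) (ν₃ j - γ j c) ∧
      (c ∈ Function.update S j₀ D₂ j → (blockPoint a w₃ v₃ j c).coeff (ν₃ j - γ j c) ≠ 0) := by
    intro j c
    rw [hw₃, hv₃, blockPoint_mul, hν₃]
    simp only [add_sub_assoc]
    rw [hr, (h₂ j c).1.coeff_single_mul s]
    exact ⟨(h₂ j c).1.single_mul s, (h₂ j c).2⟩
  have hν : ν₃ j₀ = ν₁ j₀ := by simp [hν₃, hs]
  obtain ⟨θ, hθ⟩ := exists_generic_scalar (X := Σ j, Fin m ⊕ E j)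
    (fun x => (blockPoint a w₁ v₁ x.1 x.2).coeff (min (ν₁ x.1) (ν₃ x.1) - γ x.1 x.2))
    (fun x => (blockPoint a w₃ v₃ x.1 x.2).coeff (min (ν₁ x.1) (ν₃ x.1) - γ x.1 x.2))
  refine ⟨w₁ + θ • w₃, v₁ + θ • v₃, fun j => min (ν₁ j) (ν₃ j), fun j c => ?_⟩
  rw [blockPoint_add, blockPoint_smul, HahnSeries.coeff_add, HahnSeries.coeff_smul, smul_eq_mul]
  refine ⟨((h₁ j c).1.mono (sub_le_sub_right (min_le_left _ _) _)).add
    (((h₃ j c).1.mono (sub_le_sub_right (min_le_right _ _) _)).smul θ), fun hc => ?_⟩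
  refine hθ ⟨j, c⟩ ?_
  have h1 := (h₁ j c).2
  have h3 := (h₃ j c).2
  by_cases hj : j = j₀
  · subst hj
    rw [Function.update_self] at hc h1 h3
    rw [hν] at h3
    simp only [hν, min_self]
    exact (Finset.mem_union.mp hc).imp h1 h3
  · rw [Function.update_of_ne hj] at hc h1 h3
    rcases le_total (ν₁ j) (ν₃ j) with h | h
    · left; simpa only [min_eq_left h] using h1 hc
    · right; simpa only [min_eq_right h] using h3 hc

theorem isRealized_of_forall_transversal [DecidableEq ι] [∀ j, DecidableEq (E j)]
    {S : ∀ j, Finset (Fin m ⊕ E j)}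
    (hS : ∀ j, (S j).Nonempty)
    (h : ∀ c : ∀ j, Fin m ⊕ E j, (∀ j, c j ∈ S j) → IsRealized a γ fun j => {c j}) :
    IsRealized a γ S := by
  suffices H : ∀ (s : Finset ι) (T : ∀ j, Finset (Fin m ⊕ E j)), (∀ j, (T j).Nonempty) →
      (∀ j, T j ⊆ S j) → (∀ j ∉ s, ∃ c, T j = {c}) → IsRealized a γ T from
    H Finset.univ S hS (fun _ => subset_rfl) fun j hj => absurd (Finset.mem_univ j) hj
  intro s
  induction s using Finset.induction_on with
  | empty =>
    intro T _ hT hs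
    choose c hc using fun j => hs j (Finset.notMem_empty j)
    have : T = fun j => {c j} := funext hc
    rw [this]
    exact h c fun j => hT j (by rw [hc j]; exact Finset.mem_singleton_self _)
  | insert j₀ s _ ih =>
    intro T hT hTS hs
    have hsing : ∀ c ∈ T j₀, IsRealized a γ (Function.update T j₀ {c}) := by
      intro c hc
      refine ih _ (fun j => ?_) (fun j => ?_) fun j hj => ?_
      · by_cases hj : j = j₀
        · subst hj; rw [Function.update_self]; exact Finset.singleton_nonempty c
        · rw [Function.update_of_ne hj]; exact hT j
      · by_cases hj : j = j₀
        · subst hj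
          rw [Function.update_self]
          exact Finset.singleton_subset_iff.mpr (hTS j hc)
        · rw [Function.update_of_ne hj]; exact hTS j
      · by_cases hjj : j = j₀
        · subst hjj; exact ⟨c, Function.update_self ..⟩
        · rw [Function.update_of_ne hjj]
          exact hs j (by simp [hj, hjj])
    have key : ∀ D : Finset (Fin m ⊕ E j₀), D.Nonempty → D ⊆ T j₀ →
        IsRealized a γ (Function.update T j₀ D) := by
      intro D hD
      induction hD using Finset.Nonempty.cons_induction with
      | singleton c => exact fun hc => hsing c (Finset.singleton_subset_iff.mp hc)
      | cons c D hc _ ihD =>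
        intro hD'
        rw [Finset.cons_eq_insert, Finset.insert_eq] at hD' ⊢
        exact (hsing c (hD' (Finset.mem_union_left _ (Finset.mem_singleton_self c)))).union j₀
          (ihD (Finset.union_subset_right hD'))
    have := key (T j₀) (hT j₀) subset_rfl
    rwa [Function.update_eq_self] at this

end Merge

/-- A nonzero vector orthogonal to the first `k` rows of a Vandermonde matrix has more than `k`
nonzero entries. -/
theorem lt_card_support_of_sum_pow_mul_eq_zero {K F : Type} [Field K] [DecidableEq K] [Fintype F]
    (θ : F → K) (hθ : Function.Injective θ) (p : F → K) (hp : p ≠ 0) (k : ℕ)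
    (h : ∀ s < k, ∑ c, θ c ^ s * p c = 0) :
    k < (Finset.univ.filter fun c => p c ≠ 0).card := by
  classical
  by_contra! hcard
  obtain ⟨c₀, hc₀⟩ := Function.ne_iff.mp hp
  set T := (Finset.univ.filter fun c => p c ≠ 0).erase c₀ with hT
  have hmem : c₀ ∈ Finset.univ.filter fun c => p c ≠ 0 := by simpa using hc₀
  have hTcard : T.card < k := lt_of_lt_of_le (Finset.card_erase_lt_of_mem hmem) hcard
  set P : Polynomial K := ∏ c ∈ T, (Polynomial.X - Polynomial.C (θ c)) with hP
  have hdeg : P.natDegree < k := by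
    rw [hP, Polynomial.natDegree_prod_of_monic _ _ fun c _ => Polynomial.monic_X_sub_C _]
    simpa using hTcard
  have h0 : ∑ c, P.eval (θ c) * p c = 0 := by
    simp_rw [Polynomial.eval_eq_sum_range' hdeg, Finset.sum_mul]
    rw [Finset.sum_comm]
    refine Finset.sum_eq_zero fun s hs => ?_
    simp_rw [mul_assoc]
    rw [← Finset.mul_sum, h s (Finset.mem_range.mp hs), mul_zero]
  rw [Finset.sum_eq_single c₀] at h0
  · refine mul_ne_zero ?_ hc₀ h0
    rw [hP, Polynomial.eval_prod, Finset.prod_ne_zero_iff]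
    intro c hc
    simp only [Polynomial.eval_sub, Polynomial.eval_X, Polynomial.eval_C]
    exact sub_ne_zero.mpr fun h' => (Finset.ne_of_mem_erase hc) (hθ h').symm
  · intro c _ hc
    by_cases hpc : p c = 0
    · rw [hpc, mul_zero]
    · have : c ∈ T := Finset.mem_erase.mpr ⟨hc, by simpa using hpc⟩
      rw [hP, Polynomial.eval_prod, Finset.prod_eq_zero this (by simp), zero_mul]
  · exact fun h' => absurd (Finset.mem_univ _) h'

section

variable {Γ : Type*} {K F : Type} [AddCommGroup Γ] [LinearOrder Γ] [IsOrderedAddMonoid Γ] [Field K]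
  [Fintype F]

theorem exists_vanishesBelow_sub (γ : F → Γ) (p : F → HahnSeries Γ K) (hp : p ≠ 0) :
    ∃ ν : Γ, (∀ c, VanishesBelow (p c) (ν - γ c)) ∧ ∃ c, (p c).coeff (ν - γ c) ≠ 0 := by
  classical
  obtain ⟨c₀, hc₀⟩ := Function.ne_iff.mp hp
  obtain ⟨c, hc, hmin⟩ := Finset.exists_min_image (Finset.univ.filter fun c => p c ≠ 0)
    (fun c => (p c).order + γ c) ⟨c₀, by simpa using hc₀⟩
  refine ⟨(p c).order + γ c, fun c' g hg => ?_, c, ?_⟩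
  · by_cases hc' : p c' = 0
    · rw [hc', HahnSeries.coeff_zero]
    · refine HahnSeries.coeff_eq_zero_of_lt_order (hg.trans_le ?_)
      rw [sub_le_iff_le_add]
      exact hmin c' (by simpa using hc')
  · rw [add_sub_cancel_right]
    exact HahnSeries.coeff_order_eq_zero.not.mpr (Finset.mem_filter.mp hc).2

/-- A nonzero Hahn series point satisfying the first `k` Vandermonde equations has more than `k`
indices attaining its tropical bound. -/
theorem lt_card_attaining (γ : F → Γ) (p : F → HahnSeries Γ K) [DecidableEq K]
    (θ : F → K) (hθ : Function.Injective θ) (k : ℕ)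
    (h : ∀ s < k, ∑ c, θ c ^ s • (HahnSeries.single (γ c) (1 : K) * p c) = 0) (ν : Γ)
    (hν : ∀ c, VanishesBelow (p c) (ν - γ c)) (hne : ∃ c, (p c).coeff (ν - γ c) ≠ 0) :
    k < (Finset.univ.filter fun c => (p c).coeff (ν - γ c) ≠ 0).card := by
  refine lt_card_support_of_sum_pow_mul_eq_zero θ hθ (fun c => (p c).coeff (ν - γ c))
    (Function.ne_iff.mpr hne) k fun s hs => ?_
  have := congrArg (fun x => HahnSeries.coeff x ν) (h s hs)
  simp only [HahnSeries.coeff_sum, HahnSeries.coeff_smul, smul_eq_mul,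
    HahnSeries.coeff_zero] at this
  rw [← this]
  refine Finset.sum_congr rfl fun c _ => ?_
  have h2 := (hν c).coeff_single_mul (γ c)
  rw [add_sub_cancel] at h2
  rw [h2]

end

theorem linearIndependent_blockForm {K ι : Type} [Field K] {E : ι → Type} {m : ℕ}
    (a : Fin m → ∀ j, E j → K) (j : ι) :
    LinearIndependent K fun i => blockForm a i j := by
  rw [Fintype.linearIndependent_iff]
  intro g hg i
  have := congrFun hg (Sum.inl i)
  simpa [blockForm, Pi.single_apply, Finset.sum_apply] using this

section Existence

variable {Γ : Type*} {K ι : Type} [AddCommGroup Γ] [LinearOrder Γ] [IsOrderedAddMonoid Γ] [Field K]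
  {E : ι → Type} [∀ j, Fintype (E j)] {m : ℕ}
  {a : Fin m → ∀ j, E j → K} {γ : ∀ j, Fin m ⊕ E j → Γ}

theorem card_attaining_le [DecidableEq K] (j : ι) (hγ : Function.Injective (γ j))
    (p : Fin m ⊕ E j → HahnSeries Γ K) (hp : ∀ i, ∑ c, blockForm a i j c • p c = 0) (ν : Γ)
    (hν : ∀ c, VanishesBelow (p c) (ν - γ j c)) :
    (Finset.univ.filter fun c => (p c).coeff (ν - γ j c) ≠ 0).card ≤ Fintype.card (E j) := by
  classical
  set G : Submodule K (Fin m ⊕ E j → K) :=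
    Submodule.span K (Set.range fun i => blockForm a i j) with hG
  have hrank : m ≤ Nat.card (leads (γ j) G) := by
    refine le_trans (le_of_eq ?_) (finrank_le_card_leads (γ j) G)
    rw [hG, finrank_span_eq_card (linearIndependent_blockForm a j), Fintype.card_fin]
  have hzero : ∀ g ∈ G, ∑ c, g c • p c = 0 := by
    intro g hg
    induction hg using Submodule.span_induction with
    | mem x hx => obtain ⟨i, rfl⟩ := hx; exact hp i
    | zero => simp
    | add x y _ _ hx hy => simp [add_smul, Finset.sum_add_distrib, hx, hy]
    | smul r x _ hx =>
      simp only [Pi.smul_apply, smul_assoc]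
      rw [← Finset.smul_sum, hx, smul_zero]
  have hdisj : Disjoint (Finset.univ.filter fun c => (p c).coeff (ν - γ j c) ≠ 0)
      (leads (γ j) G).toFinset := by
    rw [Finset.disjoint_left]
    intro c hc hlead
    rw [Set.mem_toFinset] at hlead
    obtain ⟨g, hg, hgc, hmax⟩ := hlead
    refine coeff_sum_smul_ne_zero Finset.univ (γ j) p ν (fun x _ => hν x) c (Finset.mem_univ c)
      (Finset.mem_filter.mp hc).2 g hgc (fun x _ hx => ?_) ?_
    · rcases lt_trichotomy (γ j x) (γ j c) with h | h | h
      · exact Or.inr h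
      · exact absurd (hγ h) hx
      · exact Or.inl (hmax x h)
    · rw [hzero g hg, HahnSeries.coeff_zero]
  have hle := Finset.card_le_univ ((Finset.univ.filter fun c => (p c).coeff (ν - γ j c) ≠ 0) ∪
    (leads (γ j) G).toFinset)
  rw [Finset.card_union_of_disjoint hdisj, Set.toFinset_card, ← Nat.card_eq_fintype_card,
    Fintype.card_sum, Fintype.card_fin] at hle
  omega

variable [Infinite K] [Fintype ι]

theorem exists_isRealized_lt_card (a : Fin m → ∀ j, E j → K) (hγ : ∀ j, Function.Injective (γ j))
    (k : ι → ℕ) (hk : ∀ j, Fintype.card (E j) ≤ k j)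
    (hsum : ∑ j, (k j - Fintype.card (E j)) < m) :
    ∃ S : ∀ j, Finset (Fin m ⊕ E j), (∀ j, k j < (S j).card) ∧ IsRealized a γ S := by
  classical
  let θ : ∀ j, Fin m ⊕ E j → K := fun j c =>
    Infinite.natEmbedding K (Fintype.equivFin (Fin m ⊕ E j) c)
  have hθ : ∀ j, Function.Injective (θ j) := fun j =>
    (Infinite.natEmbedding K).injective.comp
      (Fin.val_injective.comp (Fintype.equivFin _).injective)
  let φ : ((Fin m → HahnSeries Γ K) × (∀ j, E j → HahnSeries Γ K)) →ₗ[HahnSeries Γ K]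
      ((Σ j, Fin (k j)) → HahnSeries Γ K) :=
    { toFun := fun x js => ∑ c, θ js.1 c ^ (js.2 : ℕ) •
        (HahnSeries.single (γ js.1 c) (1 : K) * blockPoint a x.1 x.2 js.1 c)
      map_add' := fun x y => by
        funext js
        simp [blockPoint_add, mul_add, Finset.sum_add_distrib]
      map_smul' := fun r x => by
        funext js
        have : ∀ c, blockPoint a (r • x).1 (r • x).2 js.1 c = r * blockPoint a x.1 x.2 js.1 c :=
          fun c => blockPoint_mul a r x.1 x.2 js.1 c
        simp only [this, RingHom.id_apply, Pi.smul_apply, smul_eq_mul, Finset.mul_sum,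
          Algebra.mul_smul_comm, mul_left_comm r] }
  have hker : LinearMap.ker φ ≠ ⊥ := by
    apply LinearMap.ker_ne_bot_of_finrank_lt
    rw [Module.finrank_prod, Module.finrank_fintype_fun_eq_card,
      Module.finrank_fintype_fun_eq_card, Module.finrank_pi_fintype, Fintype.card_sigma,
      Fintype.card_fin]
    simp only [Fintype.card_fin, Module.finrank_fintype_fun_eq_card]
    have : ∑ j, k j = ∑ j, (k j - Fintype.card (E j)) + ∑ j, Fintype.card (E j) := by
      rw [← Finset.sum_add_distrib]
      exact Finset.sum_congr rfl fun j _ => (Nat.sub_add_cancel (hk j)).symm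
    omega
  obtain ⟨⟨w, v⟩, hφ, hne⟩ := Submodule.exists_mem_ne_zero_of_ne_bot hker
  rw [LinearMap.mem_ker] at hφ
  have hvand : ∀ j, ∀ s < k j, ∑ c, θ j c ^ s •
      (HahnSeries.single (γ j c) (1 : K) * blockPoint a w v j c) = 0 := fun j s hs =>
    congrFun hφ ⟨j, s, hs⟩
  have hw : w ≠ 0 := by
    intro hw
    have hv : v ≠ 0 := fun hv => hne (by rw [hw, hv]; rfl)
    obtain ⟨j, hj⟩ := Function.ne_iff.mp hv
    have hp : blockPoint a w v j ≠ 0 := by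
      obtain ⟨q, hq⟩ := Function.ne_iff.mp hj
      exact fun h => hq (congrFun h (Sum.inr q))
    obtain ⟨ν, hν, hνne⟩ := exists_vanishesBelow_sub (γ j) _ hp
    have h1 := lt_card_attaining (γ j) _ (θ j) (hθ j) (k j) (hvand j) ν hν hνne
    have h2 := card_attaining_le (a := a) j (hγ j) _
      (fun i => by rw [sum_blockForm_smul_blockPoint, hw]; rfl) ν hν
    exact absurd (h1.trans_le h2) (not_lt.mpr (hk j))
  have hp : ∀ j, blockPoint a w v j ≠ 0 := by
    intro j h
    apply hw
    funext i
    rw [← sum_blockForm_smul_blockPoint a w v i j, h]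
    simp
  choose ν hν hνne using fun j => exists_vanishesBelow_sub (γ j) _ (hp j)
  refine ⟨fun j => Finset.univ.filter fun c => (blockPoint a w v j c).coeff (ν j - γ j c) ≠ 0,
    fun j => lt_card_attaining (γ j) _ (θ j) (hθ j) (k j) (hvand j) (ν j) (hν j) (hνne j),
    w, v, ν, fun j c => ⟨hν j c, fun hc => (Finset.mem_filter.mp hc).2⟩⟩

end Existence

/-- Exponent vectors exceeding `r` by less than `m` in total. -/
def boundedExcess {ι : Type} [Fintype ι] (r : ι → ℕ) (m : ℕ) : Set (ι → ℕ) :=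
  {i | ∑ j, (i j - r j) < m}

theorem finite_boundedExcess {ι : Type} [Fintype ι] (r : ι → ℕ) (m : ℕ) :
    (boundedExcess r m).Finite := by
  classical
  refine (Set.finite_Iic fun j => r j + m).subset fun i hi j => ?_
  have h1 : i j - r j ≤ ∑ j, (i j - r j) :=
    Finset.single_le_sum (f := fun j => i j - r j) (fun _ _ => Nat.zero_le _) (Finset.mem_univ j)
  have h2 : ∑ j, (i j - r j) < m := hi
  simp only
  omega

/-- The transversals which are realised on their own. -/
def realizedTransversals {Γ : Type*} {K ι : Type} [AddCommGroup Γ] [LinearOrder Γ]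
    [IsOrderedAddMonoid Γ] [Field K] {E : ι → Type} [∀ j, Fintype (E j)] {m : ℕ}
    (a : Fin m → ∀ j, E j → K) (γ : ∀ j, Fin m ⊕ E j → Γ) : Set (∀ j, Fin m ⊕ E j) :=
  {c | IsRealized a γ fun j => {c j}}

theorem card_boundedExcess_le {Γ : Type*} {K ι : Type} [AddCommGroup Γ] [LinearOrder Γ]
    [IsOrderedAddMonoid Γ] [Field K] [Infinite K] [Fintype ι] {E : ι → Type}
    [∀ j, Fintype (E j)] {m : ℕ} (a : Fin m → ∀ j, E j → K) {γ : ∀ j, Fin m ⊕ E j → Γ}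
    (hγ : ∀ j, Function.Injective (γ j)) :
    Nat.card (boundedExcess (fun j => Fintype.card (E j)) m) ≤
      Nat.card (realizedTransversals a γ) := by
  classical
  have := (finite_boundedExcess (fun j => Fintype.card (E j)) m).fintype
  let θ : ∀ j, Fin m ⊕ E j → K := fun j c =>
    Infinite.natEmbedding K (Fintype.equivFin (Fin m ⊕ E j) c)
  have hθ : ∀ j, Function.Injective (θ j) := fun j =>
    (Infinite.natEmbedding K).injective.comp
      (Fin.val_injective.comp (Fintype.equivFin _).injective)
  let e : boundedExcess (fun j => Fintype.card (E j)) m → ι →₀ ℕ :=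
    fun i => Finsupp.equivFunOnFinite.symm i.1
  have he : Function.Injective e :=
    Finsupp.equivFunOnFinite.symm.injective.comp Subtype.val_injective
  have hli : LinearIndependent K
      fun (i : boundedExcess (fun j => Fintype.card (E j)) m) (c : realizedTransversals a γ) =>
        ∏ j, θ j (c.1 j) ^ i.1 j := by
    rw [Fintype.linearIndependent_iff]
    by_contra! hcon
    obtain ⟨g, hg, i₁, hi₁⟩ := hcon
    set f : MvPolynomial ι K := ∑ i, monomial (e i) (g i) with hf
    have hcoeff : ∀ i, f.coeff (e i) = g i := by
      intro i
      rw [hf, coeff_sum, Finset.sum_eq_single i]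
      · rw [coeff_monomial, if_pos rfl]
      · intro i' _ hne
        rw [coeff_monomial, if_neg fun h => hne (he h)]
      · exact fun h => absurd (Finset.mem_univ i) h
    have hsupp : f.support.Nonempty := ⟨e i₁, by rw [mem_support_iff, hcoeff]; exact hi₁⟩
    obtain ⟨t, ht, hmax⟩ := Finset.exists_max_image f.support (fun s => s.degree) hsupp
    have ht' : f.totalDegree = t.degree := by
      apply le_antisymm
      · exact Finset.sup_le hmax
      · exact le_totalDegree ht
    obtain ⟨i, rfl⟩ : ∃ i, e i = t := by
      by_contra! hne
      rw [mem_support_iff, hf, coeff_sum] at ht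
      exact ht (Finset.sum_eq_zero fun i _ => by rw [coeff_monomial, if_neg (hne i)])
    have hi : ∑ j, (i.1 j - Fintype.card (E j)) < m := i.2
    obtain ⟨S, hScard, hS⟩ := exists_isRealized_lt_card a hγ
      (fun j => max (i.1 j) (Fintype.card (E j))) (fun j => le_max_right _ _)
      (lt_of_eq_of_lt (Finset.sum_congr rfl fun j _ => by omega) hi)
    obtain ⟨s, hs, hne⟩ := combinatorial_nullstellensatz_exists_eval_nonzero f (e i)
      (mem_support_iff.mp ht) ht' (fun j => (S j).image (θ j)) fun j => by
        rw [Finset.card_image_of_injective _ (hθ j)]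
        exact lt_of_le_of_lt (le_max_left _ _) (hScard j)
    choose c hcS hcs using fun j => Finset.mem_image.mp (hs j)
    obtain ⟨w, v, ν, h⟩ := hS
    have hc : c ∈ realizedTransversals a γ := ⟨w, v, ν, fun j x => ⟨(h j x).1, fun hx => by
      rw [Finset.mem_singleton] at hx
      exact (h j x).2 (hx ▸ hcS j)⟩⟩
    apply hne
    have hgc := congrFun hg ⟨c, hc⟩
    simp only [Finset.sum_apply, Pi.smul_apply, smul_eq_mul, Pi.zero_apply] at hgc
    rw [← hgc, hf, map_sum]
    refine Finset.sum_congr rfl fun i _ => ?_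
    rw [eval_monomial, Finsupp.prod_fintype _ _ fun j => pow_zero _]
    simp only [hcs]
    rfl
  have := hli.fintype_card_le_finrank
  rwa [Module.finrank_fintype_fun_eq_card, ← Nat.card_eq_fintype_card,
    ← Nat.card_eq_fintype_card] at this

@[to_additive]
theorem Fintype.prod_eq_mul_mul_prod_erase {ι : Type} {M : Type*} [Fintype ι] [DecidableEq ι]
    [CommMonoid M] (f : ι → M) {j j' : ι} (h : j ≠ j') :
    ∏ l, f l = f j * f j' * ∏ l ∈ (Finset.univ.erase j).erase j', f l := by
  rw [mul_assoc, Finset.mul_prod_erase _ f (Finset.mem_erase.mpr ⟨h.symm, Finset.mem_univ j'⟩),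
    Finset.mul_prod_erase _ f (Finset.mem_univ j)]

theorem Fintype.prod_eq_prod_of_mul_eq_mul {ι : Type} {M : Type*} [Fintype ι] [CommMonoid M]
    {f g : ι → M} {j j' : ι} (h : j ≠ j') (hmul : f j * f j' = g j * g j')
    (heq : ∀ l, l ≠ j → l ≠ j' → f l = g l) : ∏ l, f l = ∏ l, g l := by
  classical
  rw [Fintype.prod_eq_mul_mul_prod_erase f h, Fintype.prod_eq_mul_mul_prod_erase g h, hmul]
  congr 1
  refine Finset.prod_congr rfl fun l hl => ?_
  rw [Finset.mem_erase, Finset.mem_erase] at hl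
  exact heq l hl.2.1 hl.1

theorem Finset.sum_sup_Iic_sub_sup_Iio {ι : Type} [Fintype ι] [LinearOrder ι] (f : ι → ℕ)
    (s : Finset ι) (hs : ∀ x ∈ s, ∀ y < x, y ∈ s) :
    ∑ l ∈ s, ((Finset.univ.filter (· ≤ l)).sup f - (Finset.univ.filter (· < l)).sup f) =
      s.sup f := by
  induction s using Finset.induction_on_max with
  | empty => simp
  | insert a s hmax ih =>
    have ha : a ∉ s := fun h => lt_irrefl a (hmax a h)
    have hlow : ∀ x ∈ s, ∀ y < x, y ∈ s := fun x hx y hy =>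
      (Finset.mem_insert.mp (hs x (Finset.mem_insert_of_mem hx) y hy)).resolve_left
        (hy.trans (hmax x hx)).ne
    have hlt : Finset.univ.filter (· < a) = s := by
      ext y
      simp only [Finset.mem_filter, Finset.mem_univ, true_and]
      exact ⟨fun hy => (Finset.mem_insert.mp (hs a (Finset.mem_insert_self a s) y hy)).resolve_left
        hy.ne, hmax y⟩
    have hle : Finset.univ.filter (· ≤ a) = insert a s := by
      ext y
      simp only [Finset.mem_filter, Finset.mem_univ, true_and, Finset.mem_insert, le_iff_eq_or_lt,
        ← hlt]
    rw [Finset.sum_insert ha, ih hlow, hle, hlt]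
    have : s.sup f ≤ (insert a s).sup f := Finset.sup_mono (Finset.subset_insert a s)
    omega

section Tensor

variable {K ι : Type} [Field K] [Fintype ι]

/-- The pure tensor of a family of functions, as a function on the product. -/
def pureTensor {F : ι → Type} (l : ∀ j, F j → K) : (∀ j, F j) → K := fun c => ∏ j, l j (c j)

theorem sum_pureTensor_smul_prod {L : Type*} [CommRing L] [Algebra K L] {F : ι → Type}
    [DecidableEq ι] [∀ j, Fintype (F j)] (l : ∀ j, F j → K) (p : ∀ j, F j → L) :
    ∑ c, pureTensor l c • ∏ j, p j (c j) = ∏ j, ∑ x, l j x • p j x := by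
  rw [Finset.prod_univ_sum, Fintype.piFinset_univ]
  refine Finset.sum_congr rfl fun c _ => ?_
  simp only [pureTensor, Algebra.smul_def, Finset.prod_mul_distrib, map_prod]

theorem pureTensor_mem_span {F : ι → Type} [DecidableEq ι] [∀ j, Fintype (F j)]
    (b : ∀ j, F j → (F j → K)) (l : ∀ j, F j → K)
    (h : ∀ j, l j ∈ Submodule.span K (Set.range (b j))) :
    pureTensor l ∈
      Submodule.span K (Set.range fun c : ∀ j, F j => pureTensor fun j => b j (c j)) := by
  choose M hM using fun j => (Submodule.mem_span_range_iff_exists_fun K).mp (h j)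
  have : pureTensor l = ∑ c : ∀ j, F j, (∏ j, M j (c j)) • pureTensor fun j => b j (c j) := by
    funext d
    simp only [Finset.sum_apply, Pi.smul_apply, smul_eq_mul, pureTensor]
    have h1 : ∀ j, l j (d j) = ∑ x, M j x * b j x (d j) := fun j => by
      rw [← hM j]; simp
    simp only [h1]
    rw [Finset.prod_univ_sum, Fintype.piFinset_univ]
    exact Finset.sum_congr rfl fun c _ => Finset.prod_mul_distrib
  rw [this]
  exact Submodule.sum_mem _ fun c _ => Submodule.smul_mem _ _ (Submodule.subset_span ⟨c, rfl⟩)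

end Tensor

/-- The multilinear part of the ideal of `2`-minors of the matrix `blockForm a`. -/
def minorSpace {K ι : Type} [Field K] [Fintype ι] {E : ι → Type} {m : ℕ}
    (a : Fin m → ∀ j, E j → K) : Submodule K ((∀ j, Fin m ⊕ E j) → K) :=
  Submodule.span K {x | ∃ (j j' : ι) (i i' : Fin m) (l l' : ∀ j, Fin m ⊕ E j → K), j ≠ j' ∧
    l j = blockForm a i j ∧ l j' = blockForm a i' j' ∧
    l' j = blockForm a i' j ∧ l' j' = blockForm a i j' ∧
    (∀ k, k ≠ j → k ≠ j' → l k = l' k) ∧ x = pureTensor l - pureTensor l'}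

/-- The basis of linear forms in block `j` given by the block forms and the `x`-variables. -/
def blockBasis {K ι : Type} [Field K] {E : ι → Type} {m : ℕ} (a : Fin m → ∀ j, E j → K) (j : ι)
    (x : Fin m ⊕ E j) : Fin m ⊕ E j → K :=
  open Classical in Sum.elim (fun i => blockForm a i j) (fun q => Pi.single (Sum.inr q) 1) x

theorem single_mem_span_blockBasis {K ι : Type} [Field K] {E : ι → Type}
    [∀ j, Fintype (E j)] [∀ j, DecidableEq (E j)] {m : ℕ} (a : Fin m → ∀ j, E j → K) (j : ι)
    (x : Fin m ⊕ E j) :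
    (Pi.single x 1 : Fin m ⊕ E j → K) ∈ Submodule.span K (Set.range (blockBasis a j)) := by
  have hr : ∀ q, (Pi.single (Sum.inr q) 1 : Fin m ⊕ E j → K) ∈
      Submodule.span K (Set.range (blockBasis a j)) := fun q => by
    refine Submodule.subset_span ⟨Sum.inr q, ?_⟩
    simp only [blockBasis, Sum.elim_inr]
    congr!
  cases x with
  | inr q => exact hr q
  | inl i =>
    have : (Pi.single (Sum.inl i) 1 : Fin m ⊕ E j → K) =
        blockForm a i j - ∑ q, a i j q • (Pi.single (Sum.inr q) 1 : Fin m ⊕ E j → K) := by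
      funext y
      cases y with
      | inl i' => simp [blockForm, Pi.single_apply]
      | inr q => simp [blockForm, Pi.single_apply]
    rw [this]
    exact Submodule.sub_mem _ (Submodule.subset_span ⟨Sum.inl i, rfl⟩)
      (Submodule.sum_mem _ fun q _ => Submodule.smul_mem _ _ (hr q))

/-- The indices of the forms selected by a transversal are weakly increasing. -/
def IsSorted {ι : Type} [LinearOrder ι] {E : ι → Type} {m : ℕ} (c : ∀ j, Fin m ⊕ E j) : Prop :=
  ∀ j j' i i', j < j' → c j = Sum.inl i → c j' = Sum.inl i' → i ≤ i'

section Sorting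

variable {K ι : Type} [Field K] [Fintype ι] [LinearOrder ι] {E : ι → Type} {m : ℕ}

theorem pureTensor_blockBasis_mem (a : Fin m → ∀ j, E j → K) (c : ∀ j, Fin m ⊕ E j) :
    (pureTensor fun j => blockBasis a j (c j)) ∈ minorSpace a ⊔
      Submodule.span K (Set.range fun d : {d : ∀ j, Fin m ⊕ E j // IsSorted d} =>
        pureTensor fun j => blockBasis a j (d.1 j)) := by
  let val : ∀ j, Fin m ⊕ E j → ℕ := fun j => Sum.elim Fin.val fun _ => 0
  let wgt : ι → ℕ := fun j => (Finset.univ.filter (j ≤ ·)).card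
  have hwgt : ∀ j j', j < j' → wgt j' < wgt j := fun j j' h =>
    Finset.card_lt_card ⟨fun x hx => by
        simp only [Finset.mem_filter, Finset.mem_univ, true_and] at hx ⊢
        exact h.le.trans hx, fun hsub => by
        have := hsub (show j ∈ _ by simp)
        simp only [Finset.mem_filter, Finset.mem_univ, true_and] at this
        exact absurd h (not_lt.mpr this)⟩
  induction hΨ : ∑ j, wgt j * val j (c j) using Nat.strong_induction_on generalizing c with
  | _ N ih =>
    by_cases hc : IsSorted c
    · exact Submodule.mem_sup_right (Submodule.subset_span ⟨⟨c, hc⟩, rfl⟩)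
    · simp only [IsSorted, not_forall, not_le] at hc
      obtain ⟨j, j', i, i', hjj', hj, hj', hii'⟩ := hc
      set d : ∀ j, Fin m ⊕ E j :=
        Function.update (Function.update c j (Sum.inl i')) j' (Sum.inl i) with hd
      have hdj : d j = Sum.inl i' := by
        rw [hd, Function.update_of_ne hjj'.ne, Function.update_self]
      have hdj' : d j' = Sum.inl i := by rw [hd, Function.update_self]
      have hdk : ∀ k, k ≠ j → k ≠ j' → d k = c k := fun k h1 h2 => by
        rw [hd, Function.update_of_ne h2, Function.update_of_ne h1]
      have hlt : ∑ j, wgt j * val j (d j) < N := by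
        rw [← hΨ, Fintype.sum_eq_add_add_sum_erase _ hjj'.ne,
          Fintype.sum_eq_add_add_sum_erase (fun j => wgt j * val j (c j)) hjj'.ne]
        refine add_lt_add_of_lt_of_le ?_ (le_of_eq (Finset.sum_congr rfl fun k hk => ?_))
        · simp only [hdj, hdj', hj, hj', val, Sum.elim_inl]
          have h1 := hwgt j j' hjj'
          have h2 : i'.val < i.val := hii'
          nlinarith
        · rw [Finset.mem_erase, Finset.mem_erase] at hk
          rw [hdk k hk.2.1 hk.1]
      have hmem := ih _ hlt d rfl
      have hdiff : (pureTensor fun j => blockBasis a j (c j)) -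
          (pureTensor fun j => blockBasis a j (d j)) ∈ minorSpace a := by
        refine Submodule.subset_span ⟨j, j', i, i', _, _, hjj'.ne, ?_, ?_, ?_, ?_, ?_, rfl⟩
        · simp only [hj]; rfl
        · simp only [hj']; rfl
        · simp only [hdj]; rfl
        · simp only [hdj']; rfl
        · intro k h1 h2
          simp only [hdk k h1 h2]
      have := Submodule.add_mem _ (Submodule.mem_sup_left hdiff) hmem
      rwa [sub_add_cancel] at this

theorem card_isSorted_le [∀ j, Fintype (E j)] (hm : 0 < m) :
    Nat.card {c : ∀ j, Fin m ⊕ E j // IsSorted c} ≤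
      Nat.card (boundedExcess (fun j => Fintype.card (E j)) m) := by
  classical
  have := (finite_boundedExcess (fun j => Fintype.card (E j)) m).to_subtype
  let val : (∀ j, Fin m ⊕ E j) → ι → ℕ := fun c j => Sum.elim Fin.val (fun _ => 0) (c j)
  let sle : (∀ j, Fin m ⊕ E j) → ι → ℕ := fun c j => (Finset.univ.filter (· ≤ j)).sup (val c)
  let slt : (∀ j, Fin m ⊕ E j) → ι → ℕ := fun c j => (Finset.univ.filter (· < j)).sup (val c)
  let ex : (∀ j, Fin m ⊕ E j) → ι → ℕ := fun c j =>
    Sum.elim (fun _ => Fintype.card (E j) + (sle c j - slt c j))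
      (fun q => (Fintype.equivFin (E j) q : ℕ)) (c j)
  have hsle : ∀ c j, sle c j = max (val c j) (slt c j) := by
    intro c j
    have : Finset.univ.filter (· ≤ j) = insert j (Finset.univ.filter (· < j)) := by
      ext y
      simp [le_iff_eq_or_lt]
    simp only [sle, slt, this, Finset.sup_insert]
  have hexcess : ∀ c j, ex c j - Fintype.card (E j) = sle c j - slt c j := by
    intro c j
    rcases hcj : c j with i | q
    · simp [ex, hcj]
    · have h1 : val c j = 0 := by simp [val, hcj]
      have h2 := (Fintype.equivFin (E j) q).isLt
      have h3 := hsle c j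
      simp only [ex, hcj, Sum.elim_inr]
      omega
  have htel : ∀ c (s : Finset ι), (∀ x ∈ s, ∀ y < x, y ∈ s) →
      ∑ j ∈ s, (ex c j - Fintype.card (E j)) = s.sup (val c) := fun c s hs => by
    simp only [hexcess]
    exact Finset.sum_sup_Iic_sub_sup_Iio (val c) s hs
  have hval : ∀ c j, val c j < m := by
    intro c j
    rcases hcj : c j with i | q
    · simp [val, hcj]
    · simpa [val, hcj] using hm
  have hmem : ∀ c, ex c ∈ boundedExcess (fun j => Fintype.card (E j)) m := by
    intro c
    change ∑ j, (ex c j - Fintype.card (E j)) < m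
    rw [htel c Finset.univ fun _ _ _ _ => Finset.mem_univ _]
    exact (Finset.sup_lt_iff hm).mpr fun j _ => hval c j
  refine Nat.card_le_card_of_injective
    (fun c : {c : ∀ j, Fin m ⊕ E j // IsSorted c} => ⟨ex c.1, hmem c.1⟩) ?_
  rintro ⟨c, hc⟩ ⟨d, hd⟩ h
  have hex : ex c = ex d := congrArg Subtype.val h
  have hsorted : ∀ c : ∀ j, Fin m ⊕ E j, IsSorted c → ∀ j i, c j = Sum.inl i →
      sle c j = i := by
    intro c hc j i hj
    have hvj : val c j = i := by simp [val, hj]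
    rw [hsle, hvj]
    refine max_eq_left (Finset.sup_le fun l hl => ?_)
    rcases hcl : c l with i' | q
    · have := hc l j i' i (Finset.mem_filter.mp hl).2 hcl hj
      simpa [val, hcl] using this
    · simp [val, hcl]
  have hsleq : ∀ j, sle c j = sle d j := by
    intro j
    have hlow : ∀ x ∈ Finset.univ.filter (· ≤ j), ∀ y < x, y ∈ Finset.univ.filter (· ≤ j) := by
      intro x hx y hy
      simp only [Finset.mem_filter, Finset.mem_univ, true_and] at hx ⊢
      exact hy.le.trans hx
    have h1 := htel c _ hlow
    have h2 := htel d _ hlow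
    rw [hex, h2] at h1
    exact h1.symm
  refine Subtype.ext (funext fun j => ?_)
  have hj := congrFun hex j
  rcases hcj : c j with i | q <;> rcases hdj : d j with i' | q'
  · have h1 := hsorted c hc j i hcj
    rw [hsleq j, hsorted d hd j i' hdj] at h1
    exact hcj.trans ((congrArg Sum.inl (Fin.ext h1.symm)).trans hdj.symm)
  · have := (Fintype.equivFin (E j) q').isLt
    simp only [ex, hcj, hdj, Sum.elim_inl, Sum.elim_inr] at hj
    omega
  · have := (Fintype.equivFin (E j) q).isLt
    simp only [ex, hcj, hdj, Sum.elim_inl, Sum.elim_inr] at hj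
    omega
  · simp only [ex, hcj, hdj, Sum.elim_inr] at hj
    exact hcj.trans ((congrArg Sum.inr ((Fintype.equivFin (E j)).injective (Fin.ext hj))).trans
      hdj.symm)

theorem card_le_finrank_minorSpace_add [∀ j, Fintype (E j)] (hm : 0 < m)
    (a : Fin m → ∀ j, E j → K) :
    Nat.card (∀ j, Fin m ⊕ E j) ≤ Module.finrank K (minorSpace a) +
      Nat.card (boundedExcess (fun j => Fintype.card (E j)) m) := by
  classical
  set Q := Submodule.span K (Set.range fun d : {d : ∀ j, Fin m ⊕ E j // IsSorted d} =>
    pureTensor fun j => blockBasis a j (d.1 j)) with hQ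
  have htop : minorSpace a ⊔ Q = ⊤ := by
    rw [eq_top_iff]
    rintro g -
    rw [pi_eq_sum_univ' g]
    refine Submodule.sum_mem _ fun c _ => Submodule.smul_mem _ _ ?_
    have h1 : (Pi.single c 1 : (∀ j, Fin m ⊕ E j) → K) =
        pureTensor fun j => (Pi.single (c j) 1 : Fin m ⊕ E j → K) := by
      funext d
      simp only [pureTensor, Pi.single_apply]
      rw [Finset.prod_ite_zero]
      simp [funext_iff]
    rw [h1]
    have h2 := pureTensor_mem_span (blockBasis a) _ fun j =>
      single_mem_span_blockBasis a j (c j)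
    refine Submodule.span_le.mpr ?_ h2
    rintro _ ⟨d, rfl⟩
    exact pureTensor_blockBasis_mem a d
  have h1 := Submodule.finrank_add_le_finrank_add_finrank (minorSpace a) Q
  rw [htop, finrank_top, Module.finrank_fintype_fun_eq_card] at h1
  have h2 : Module.finrank K Q ≤ Nat.card {d : ∀ j, Fin m ⊕ E j // IsSorted d} := by
    rw [Nat.card_eq_fintype_card]
    exact finrank_range_le_card _
  have h3 := card_isSorted_le (E := E) hm
  rw [Nat.card_eq_fintype_card]
  omega

end Sorting

section Core

variable {Γ : Type*} {K ι : Type} [Field K] [Fintype ι] [LinearOrder ι] {E : ι → Type}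
  [∀ j, Fintype (E j)] {m : ℕ}

theorem sum_smul_prod_blockPoint_eq_zero {L : Type*} [CommRing L] [Algebra K L]
    (a : Fin m → ∀ j, E j → K) (w : Fin m → L) (v : ∀ j, E j → L)
    {g : (∀ j, Fin m ⊕ E j) → K} (hg : g ∈ minorSpace a) :
    ∑ c, g c • ∏ j, blockPoint a w v j (c j) = 0 := by
  induction hg using Submodule.span_induction with
  | mem x hx =>
    obtain ⟨j, j', i, i', l, l', hjj', hj, hj', hlj, hlj', hk, rfl⟩ := hx
    simp only [Pi.sub_apply, sub_smul, Finset.sum_sub_distrib]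
    rw [sum_pureTensor_smul_prod, sum_pureTensor_smul_prod, sub_eq_zero]
    refine Fintype.prod_eq_prod_of_mul_eq_mul hjj' ?_ fun k h1 h2 => by rw [hk k h1 h2]
    simp only [hj, hj', hlj, hlj', sum_blockForm_smul_blockPoint]
    exact mul_comm _ _
  | zero => simp
  | add x y _ _ hx hy => simp [add_smul, Finset.sum_add_distrib, hx, hy]
  | smul r x _ hx =>
    simp only [Pi.smul_apply, smul_assoc]
    rw [← Finset.smul_sum, hx, smul_zero]

variable [AddCommGroup Γ] [LinearOrder Γ] [IsOrderedAddMonoid Γ]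

theorem disjoint_realizedTransversals_leads (a : Fin m → ∀ j, E j → K)
    (γ : ∀ j, Fin m ⊕ E j → Γ)
    (hκ : Function.Injective fun c : ∀ j, Fin m ⊕ E j => ∑ j, γ j (c j)) :
    Disjoint (realizedTransversals a γ)
      (leads (fun c : ∀ j, Fin m ⊕ E j => ∑ j, γ j (c j)) (minorSpace a)) := by
  rw [Set.disjoint_left]
  rintro c ⟨w, v, ν, h⟩ ⟨g, hg, hgc, hmax⟩
  have hprod : ∀ d : ∀ j, Fin m ⊕ E j,
      VanishesBelow (∏ j, blockPoint a w v j (d j)) (∑ j, ν j - ∑ j, γ j (d j)) ∧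
      (∏ j, blockPoint a w v j (d j)).coeff (∑ j, ν j - ∑ j, γ j (d j)) =
        ∏ j, (blockPoint a w v j (d j)).coeff (ν j - γ j (d j)) := fun d => by
    rw [← Finset.sum_sub_distrib]
    exact VanishesBelow.prod _ fun j _ => (h j (d j)).1
  refine coeff_sum_smul_ne_zero Finset.univ (fun c : ∀ j, Fin m ⊕ E j => ∑ j, γ j (c j))
    (fun d => ∏ j, blockPoint a w v j (d j)) (∑ j, ν j) (fun d _ => (hprod d).1) c
    (Finset.mem_univ c) ?_ g hgc (fun d _ hd => ?_) ?_
  · rw [(hprod c).2]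
    exact Finset.prod_ne_zero_iff.mpr fun j _ => (h j (c j)).2 (Finset.mem_singleton_self _)
  · rcases lt_trichotomy (∑ j, γ j (d j)) (∑ j, γ j (c j)) with h' | h' | h'
    · exact Or.inr h'
    · exact absurd (hκ h') hd
    · exact Or.inl (hmax d h')
  · rw [sum_smul_prod_blockPoint_eq_zero a w v hg, HahnSeries.coeff_zero]

variable [Infinite K]

theorem mem_realizedTransversals_or_mem_leads (hm : 0 < m) (a : Fin m → ∀ j, E j → K)
    (γ : ∀ j, Fin m ⊕ E j → Γ) (hγ : ∀ j, Function.Injective (γ j))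
    (hκ : Function.Injective fun c : ∀ j, Fin m ⊕ E j => ∑ j, γ j (c j))
    (c : ∀ j, Fin m ⊕ E j) :
    c ∈ realizedTransversals a γ ∨
      c ∈ leads (fun c : ∀ j, Fin m ⊕ E j => ∑ j, γ j (c j)) (minorSpace a) := by
  classical
  set R := realizedTransversals a γ with hR
  set Λ := leads (fun c : ∀ j, Fin m ⊕ E j => ∑ j, γ j (c j)) (minorSpace a) with hΛ
  have h1 := card_le_finrank_minorSpace_add hm a
  have h2 := card_boundedExcess_le a hγ
  rw [← hR] at h2
  have h3 := finrank_le_card_leads (fun c : ∀ j, Fin m ⊕ E j => ∑ j, γ j (c j)) (minorSpace a)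
  rw [← hΛ] at h3
  have hdisj : Disjoint R.toFinset Λ.toFinset :=
    Set.disjoint_toFinset.mpr (disjoint_realizedTransversals_leads a γ hκ)
  have hcard := Finset.card_union_of_disjoint hdisj
  rw [Set.toFinset_card, Set.toFinset_card, ← Nat.card_eq_fintype_card,
    ← Nat.card_eq_fintype_card] at hcard
  rw [Nat.card_eq_fintype_card] at h1
  have huniv : R.toFinset ∪ Λ.toFinset = Finset.univ := by
    rw [← Finset.card_eq_iff_eq_univ]
    exact le_antisymm (Finset.card_le_univ _) (by omega)
  have hc := Finset.mem_univ c
  rw [← huniv, Finset.mem_union, Set.mem_toFinset, Set.mem_toFinset] at hc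
  exact hc

/-- Either the minors have a lead supported on a given box, or the whole box is realised by a
single point. -/
theorem exists_mem_leads_or_isRealized (hm : 0 < m) (a : Fin m → ∀ j, E j → K)
    (γ : ∀ j, Fin m ⊕ E j → Γ) (hγ : ∀ j, Function.Injective (γ j))
    (hκ : Function.Injective fun c : ∀ j, Fin m ⊕ E j => ∑ j, γ j (c j))
    (S : ∀ j, Finset (Fin m ⊕ E j)) (hS : ∀ j, (S j).Nonempty) :
    (∃ c, (∀ j, c j ∈ S j) ∧
      c ∈ leads (fun c : ∀ j, Fin m ⊕ E j => ∑ j, γ j (c j)) (minorSpace a)) ∨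
    IsRealized a γ S := by
  classical
  by_cases h : ∀ c : ∀ j, Fin m ⊕ E j, (∀ j, c j ∈ S j) → IsRealized a γ fun j => {c j}
  · exact Or.inr (isRealized_of_forall_transversal hS h)
  · push Not at h
    obtain ⟨c, hcS, hc⟩ := h
    exact Or.inl ⟨c, hcS, (mem_realizedTransversals_or_mem_leads hm a γ hγ hκ c).resolve_left hc⟩

end Core

section Weights

/-- An ordered group of weights refining a total degree, then a given term order, then a generic
tie-break. The functional `tie x` detects the weight of the index `x`. -/
structure TermWeight {ι : Type} {E : ι → Type} (τ : MonomialOrder (Σ j, E j)) (m : ℕ)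
    (Γ : Type*) [AddCommGroup Γ] [LinearOrder Γ] where
  /-- The weights of the indices. -/
  weight : ∀ j, Fin m ⊕ E j → Γ
  /-- The total degree of a weight. -/
  deg : Γ →+ ℤ
  /-- A weight of degree one. -/
  unit : Γ
  /-- The functionals separating the indices. -/
  tie : (Σ j, Fin m ⊕ E j) → Γ →+ ℤ
  monotone_deg : Monotone deg
  deg_unit : deg unit = 1
  deg_inl : ∀ j i, deg (weight j (Sum.inl i)) = 0
  deg_inr : ∀ j q, deg (weight j (Sum.inr q)) = 1
  tie_self : ∀ j c, tie ⟨j, c⟩ (weight j c) = 1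
  tie_of_ne : ∀ x j c, x ≠ ⟨j, c⟩ → tie x (weight j c) = 0
  lt_of_lt : ∀ s t : (Σ j, E j) →₀ ℕ, s.degree = t.degree → τ.toSyn s < τ.toSyn t →
    s.sum (fun p k => k • weight p.1 (Sum.inr p.2)) <
      t.sum (fun p k => k • weight p.1 (Sum.inr p.2))

theorem exists_termWeight.{u} {ι : Type} {E : ι → Type} [Fintype ι] [∀ j, Fintype (E j)]
    (τ : MonomialOrder.{0, u} (Σ j, E j)) (m : ℕ) :
    ∃ (Γ : Type u) (_ : AddCommGroup Γ) (_ : LinearOrder Γ),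
      IsOrderedAddMonoid Γ ∧ Nonempty (TermWeight τ m Γ) := by
  classical
  let X := Σ j, Fin m ⊕ E j
  let k := Fintype.card X
  let idx : X ≃ Fin k := Fintype.equivFin X
  let G := Algebra.GrothendieckAddGroup τ.syn
  let T := Lex (Fin k → ℤ)
  let Γ := ℤ ×ₗ (G ×ₗ T)
  let deg : Γ →+ ℤ :=
    { toFun := fun g => (ofLex g).1, map_zero' := rfl, map_add' := fun _ _ => rfl }
  let mid : Γ →+ G :=
    { toFun := fun g => (ofLex (ofLex g).2).1, map_zero' := rfl, map_add' := fun _ _ => rfl }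
  let tie : X → Γ →+ ℤ := fun x =>
    { toFun := fun g => ofLex (ofLex (ofLex g).2).2 (idx x)
      map_zero' := rfl
      map_add' := fun _ _ => rfl }
  let weight : ∀ j, Fin m ⊕ E j → Γ := fun j c =>
    toLex (Sum.elim (fun _ => 0) (fun _ => 1) c,
      toLex (Sum.elim (fun _ => 0)
        (fun q => Algebra.GrothendieckAddGroup.of (τ.toSyn (Finsupp.single ⟨j, q⟩ 1))) c,
        toLex (Pi.single (idx ⟨j, c⟩) 1)))
  refine ⟨Γ, inferInstance, inferInstance, inferInstance, ⟨{
    weight := weight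
    deg := deg
    unit := toLex (1, 0)
    tie := tie
    monotone_deg := Prod.Lex.monotone_fst
    deg_unit := rfl
    deg_inl := fun _ _ => rfl
    deg_inr := fun _ _ => rfl
    tie_self := fun j c => Pi.single_eq_same _ _
    tie_of_ne := fun x j c h => Pi.single_eq_of_ne (idx.injective.ne h) _
    lt_of_lt := ?_ }⟩⟩
  intro s t hdeg hlt
  let W : ((Σ j, E j) →₀ ℕ) → Γ := fun s => s.sum fun p k => k • weight p.1 (Sum.inr p.2)
  have hW1 : ∀ s, deg (W s) = s.degree := fun s => by
    rw [Finsupp.degree_apply, Nat.cast_sum]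
    simp only [W, Finsupp.sum, map_sum, map_nsmul]
    refine Finset.sum_congr rfl fun p _ => ?_
    change s p • (1 : ℤ) = _
    simp
  have hW2 : ∀ s, mid (W s) = Algebra.GrothendieckAddGroup.of (τ.toSyn s) := fun s => by
    simp only [W, Finsupp.sum, map_sum, map_nsmul]
    conv_rhs => rw [← Finsupp.sum_single s]
    simp only [Finsupp.sum, map_sum]
    refine Finset.sum_congr rfl fun p _ => ?_
    change s p • Algebra.GrothendieckAddGroup.of (τ.toSyn (Finsupp.single p 1)) = _
    rw [← map_nsmul, ← map_nsmul, Finsupp.smul_single, smul_eq_mul, mul_one]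
  change W s < W t
  rw [Prod.Lex.lt_iff]
  refine Or.inr ⟨?_, ?_⟩
  · change deg (W s) = deg (W t)
    rw [hW1, hW1, hdeg]
  · rw [Prod.Lex.lt_iff]
    refine Or.inl ?_
    change mid (W s) < mid (W t)
    rw [hW2, hW2]
    exact AddLocalization.mk_lt_mk.mpr (by simpa using hlt)

namespace TermWeight

variable {ι : Type} {E : ι → Type} {τ : MonomialOrder (Σ j, E j)} {m : ℕ} {Γ : Type*}
  [AddCommGroup Γ] [LinearOrder Γ] (ω : TermWeight τ m Γ)

theorem weight_injective (j : ι) : Function.Injective (ω.weight j) := fun c d h => by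
  by_contra hne
  have h1 := ω.tie_self j c
  rw [h, ω.tie_of_ne _ _ _ fun h => hne (by simpa using h)] at h1
  exact zero_ne_one h1

theorem sum_weight_injective (p : ι → Prop) [Fintype (Subtype p)] :
    Function.Injective fun c : ∀ j : Subtype p, Fin m ⊕ E j =>
      ∑ j : Subtype p, ω.weight j (c j) := by
  classical
  have key : ∀ (c : ∀ j : Subtype p, Fin m ⊕ E j) (j : Subtype p) (x : Fin m ⊕ E j),
      ω.tie ⟨j, x⟩ (∑ j : Subtype p, ω.weight j (c j)) = ω.tie ⟨j, x⟩ (ω.weight j (c j)) := by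
    intro c j x
    rw [map_sum]
    refine Finset.sum_eq_single j (fun l _ hl => ω.tie_of_ne _ _ _ fun h => hl ?_)
      fun h => absurd (Finset.mem_univ j) h
    exact Subtype.ext (congrArg Sigma.fst h).symm
  intro c d h
  funext j
  by_contra hne
  have h1 := key c j (c j)
  simp only at h
  rw [h, key, ω.tie_self, ω.tie_of_ne _ _ _ fun h => hne (by simpa using h)] at h1
  exact zero_ne_one h1

end TermWeight

end Weights

/-- The Hahn series all of whose exponents have degree at least `k`. -/
def degreeFiltration {Γ : Type*} (K : Type) [AddCommGroup Γ] [LinearOrder Γ] [Field K]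
    (deg : Γ →+ ℤ) (k : ℤ) : Submodule K (HahnSeries Γ K) where
  carrier := {x | ∀ g, x.coeff g ≠ 0 → k ≤ deg g}
  zero_mem' := fun _ h => absurd rfl h
  add_mem' := fun {x y} hx hy g hg => by
    by_cases h : x.coeff g = 0
    · rw [HahnSeries.coeff_add, h, zero_add] at hg
      exact hy g hg
    · exact hx g h
  smul_mem' := fun c x hx g hg => hx g fun h => hg (by rw [HahnSeries.coeff_smul, h, smul_zero])

section DegreeFiltration

variable {Γ : Type*} {K : Type} [AddCommGroup Γ] [LinearOrder Γ] [Field K] {deg : Γ →+ ℤ}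

theorem VanishesBelow.mem_degreeFiltration {x : HahnSeries Γ K} {a : Γ} (hx : VanishesBelow x a)
    (hdeg : Monotone deg) : x ∈ degreeFiltration K deg (deg a) := fun _ hg =>
  hdeg (hx.le_of_coeff_ne_zero hg)

theorem degreeFiltration_anti {k l : ℤ} (h : k ≤ l) :
    degreeFiltration K deg l ≤ degreeFiltration K deg k := fun _ hx g hg => h.trans (hx g hg)

theorem mul_mem_degreeFiltration [IsOrderedAddMonoid Γ] {x y : HahnSeries Γ K} {k l : ℤ}
    (hx : x ∈ degreeFiltration K deg k) (hy : y ∈ degreeFiltration K deg l) :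
    x * y ∈ degreeFiltration K deg (k + l) := fun g hg => by
  rw [HahnSeries.coeff_mul] at hg
  obtain ⟨p, hp, _⟩ := Finset.exists_ne_zero_of_sum_ne_zero hg
  rw [Finset.mem_antidiagonal] at hp
  rw [← hp.2.2, map_add]
  exact add_le_add (hx _ hp.1) (hy _ hp.2.1)

theorem algebraMap_mem_degreeFiltration [IsOrderedAddMonoid Γ] (c : K) :
    algebraMap K (HahnSeries Γ K) c ∈ degreeFiltration K deg 0 := fun g hg => by
  rw [HahnSeries.algebraMap_apply, HahnSeries.C_apply] at hg
  have : g = 0 := by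
    by_contra h
    exact hg (HahnSeries.coeff_single_of_ne h)
  simp [this]

theorem aeval_mem_degreeFiltration [IsOrderedAddMonoid Γ] {σ : Type} {x : σ → HahnSeries Γ K}
    (hx : ∀ p, x p ∈ degreeFiltration K deg 0) (f : MvPolynomial σ K) :
    aeval x f ∈ degreeFiltration K deg 0 := by
  induction f using MvPolynomial.induction_on with
  | C c => rw [aeval_C]; exact algebraMap_mem_degreeFiltration c
  | add f g hf hg => rw [map_add]; exact Submodule.add_mem _ hf hg
  | mul_X f p hf =>
    rw [map_mul, aeval_X]
    simpa using mul_mem_degreeFiltration hf (hx p)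

end DegreeFiltration

/-- The ideal generated by the `2`-minors of a matrix, including the degenerate ones. -/
def twoMinors {R κ ι : Type} [CommRing R] (A : Matrix κ ι R) : Ideal R :=
  Ideal.span {x | ∃ i i' j j', x = A i j * A i' j' - A i' j * A i j'}

/-- The matrix whose `j`-th column consists of linear forms in the `j`-th block of variables. -/
def formMatrix {K ι : Type} [Field K] {E : ι → Type} [∀ j, Fintype (E j)] {m : ℕ}
    (a : Fin m → ∀ j, E j → K) : Matrix (Fin m) ι (MvPolynomial (Σ j, E j) K) :=
  fun i j => ∑ q, a i j q • X ⟨j, q⟩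

section Exponent

variable {ι : Type} {E : ι → Type} {p : ι → Prop} [Fintype (Subtype p)]

theorem weight_single_fst_apply [DecidableEq ι] [Fintype ι] [∀ j, Fintype (E j)]
    (s : (Σ j, E j) →₀ ℕ) (j : ι) :
    Finsupp.weight (fun x : Σ j, E j => (Pi.single x.1 1 : ι → ℕ)) s j = ∑ q, s ⟨j, q⟩ := by
  rw [Finsupp.weight_apply, Finsupp.sum_fintype s
    (fun x k => k • (Pi.single x.1 1 : ι → ℕ)) (fun _ => zero_smul ℕ _), Finset.sum_apply,
    Fintype.sum_sigma, Finset.sum_eq_single j]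
  · simp
  · intro l _ hl
    simp [Pi.single_eq_of_ne hl.symm]
  · simp

/-- The exponent of the monomial which is the product of the variables selected by `x`. -/
def transversalExponent (x : ∀ j : Subtype p, E j) : (Σ j, E j) →₀ ℕ :=
  ∑ j : Subtype p, Finsupp.single ⟨j, x j⟩ 1

theorem transversalExponent_apply [∀ j, DecidableEq (E j)] (x : ∀ j : Subtype p, E j)
    (j : Subtype p) (q : E j) :
    transversalExponent x ⟨j, q⟩ = if x j = q then 1 else 0 := by
  classical
  rw [transversalExponent, Finsupp.finsetSum_apply, Finset.sum_eq_single j]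
  · simp [Finsupp.single_apply]
  · intro l _ hl
    rw [Finsupp.single_apply, if_neg fun h => hl (Subtype.ext (congrArg Sigma.fst h))]
  · simp

theorem transversalExponent_apply_of_not (x : ∀ j : Subtype p, E j) {j : ι} (hj : ¬p j)
    (q : E j) : transversalExponent x ⟨j, q⟩ = 0 := by
  classical
  rw [transversalExponent, Finsupp.finsetSum_apply]
  refine Finset.sum_eq_zero fun l _ => ?_
  have hne : (⟨l, x l⟩ : Σ j, E j) ≠ ⟨j, q⟩ := fun h => hj (by
    have h1 : (l : ι) = j := congrArg Sigma.fst h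
    rw [← h1]
    exact l.2)
  rw [Finsupp.single_apply, if_neg hne]

theorem transversalExponent_injective :
    Function.Injective (transversalExponent : (∀ j : Subtype p, E j) → _) := by
  classical
  intro x y h
  funext j
  have h1 := transversalExponent_apply x j (x j)
  rw [h, transversalExponent_apply, if_pos rfl] at h1
  by_contra hne
  rw [if_neg fun h => hne h.symm] at h1
  exact zero_ne_one h1

theorem degree_transversalExponent (x : ∀ j : Subtype p, E j) :
    (transversalExponent x).degree = Fintype.card (Subtype p) := by
  simp [transversalExponent, map_sum]

theorem sum_transversalExponent {M : Type*} [AddCommMonoid M] (f : (Σ j, E j) → M)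
    (x : ∀ j : Subtype p, E j) :
    ((transversalExponent x).sum fun y k => k • f y) = ∑ j : Subtype p, f ⟨j, x j⟩ := by
  have h : ∀ s : (Σ j, E j) →₀ ℕ, (s.sum fun y k => k • f y) = Finsupp.weight f s := fun s =>
    (Finsupp.weight_apply f s).symm
  rw [h, transversalExponent, map_sum]
  simp [Finsupp.weight_single]

theorem smul_prod_X_eq_monomial {K : Type} [Field K] (x : ∀ j : Subtype p, E j)
    (r : K) :
    r • ∏ j : Subtype p, (X ⟨j, x j⟩ : MvPolynomial (Σ j, E j) K) =
      monomial (transversalExponent x) r := by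
  have h : monomial (transversalExponent x) r = r • monomial (transversalExponent x) (1 : K) := by
    rw [smul_monomial, smul_eq_mul, mul_one]
  rw [h, transversalExponent, monomial_sum_one]
  rfl

end Exponent

section Ideal

variable {K ι : Type} [Field K] {E : ι → Type} [∀ j, Fintype (E j)] {m : ℕ}
  {p : ι → Prop} [Fintype (Subtype p)]

theorem sum_smul_prod_X_mem_twoMinors [DecidableEq ι] (a : Fin m → ∀ j, E j → K)
    {g : (∀ j : Subtype p, Fin m ⊕ E j) → K}
    (hg : g ∈ minorSpace fun i (j : Subtype p) => a i j) :
    ∑ x : ∀ j : Subtype p, E j, g (fun j => Sum.inr (x j)) •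
      ∏ j : Subtype p, (X ⟨j, x j⟩ : MvPolynomial (Σ j, E j) K) ∈ twoMinors (formMatrix a) := by
  classical
  induction hg using Submodule.span_induction with
  | mem x hx =>
    obtain ⟨j, j', i, i', l, l', hjj', hj, hj', hlj, hlj', hk, rfl⟩ := hx
    have key : ∀ l : ∀ j : Subtype p, Fin m ⊕ E j → K,
        ∑ x : ∀ j : Subtype p, E j, pureTensor l (fun j => Sum.inr (x j)) •
          ∏ j : Subtype p, (X ⟨j, x j⟩ : MvPolynomial (Σ j, E j) K) =
        ∏ j : Subtype p, ∑ q, l j (Sum.inr q) • (X ⟨j, q⟩ : MvPolynomial (Σ j, E j) K) :=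
      fun l => sum_pureTensor_smul_prod (fun (j : Subtype p) q => l j (Sum.inr q))
        (fun j q => (X ⟨j, q⟩ : MvPolynomial (Σ j, E j) K))
    simp only [Pi.sub_apply, sub_smul, Finset.sum_sub_distrib]
    rw [key, key, Fintype.prod_eq_mul_mul_prod_erase _ hjj',
      Fintype.prod_eq_mul_mul_prod_erase (fun j : Subtype p => ∑ q, l' j (Sum.inr q) •
        (X ⟨j, q⟩ : MvPolynomial (Σ j, E j) K)) hjj']
    have hrest : ∏ j ∈ (Finset.univ.erase j).erase j', ∑ q, l j (Sum.inr q) •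
          (X ⟨j, q⟩ : MvPolynomial (Σ j, E j) K) =
        ∏ j ∈ (Finset.univ.erase j).erase j', ∑ q, l' j (Sum.inr q) •
          (X ⟨j, q⟩ : MvPolynomial (Σ j, E j) K) := by
      refine Finset.prod_congr rfl fun k hk' => ?_
      rw [Finset.mem_erase, Finset.mem_erase] at hk'
      rw [hk k hk'.2.1 hk'.1]
    rw [hrest, ← sub_mul]
    refine Ideal.mul_mem_right _ _ (Ideal.subset_span ⟨i, i', j, j', ?_⟩)
    rw [hj, hj', hlj, hlj']
    rfl
  | zero => simp
  | add x y _ _ hx hy =>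
    simp only [Pi.add_apply, add_smul, Finset.sum_add_distrib]
    exact Ideal.add_mem _ hx hy
  | smul r x _ hx =>
    simp only [Pi.smul_apply, smul_assoc]
    rw [← Finset.smul_sum]
    exact Submodule.smul_of_tower_mem _ r hx

variable {Γ : Type*} [AddCommGroup Γ] [LinearOrder Γ] [IsOrderedAddMonoid Γ]

theorem mem_degreeFiltration_of_mem_twoMinors {deg : Γ →+ ℤ} (a : Fin m → ∀ j, E j → K)
    {x : (Σ j, E j) → HahnSeries Γ K} (hx : ∀ y, x y ∈ degreeFiltration K deg 0)
    (t : ι → HahnSeries Γ K) (w : Fin m → HahnSeries Γ K)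
    (hA : ∀ i j, t j * w i - ∑ q, a i j q • x ⟨j, q⟩ ∈ degreeFiltration K deg 1)
    {f : MvPolynomial (Σ j, E j) K} (hf : f ∈ twoMinors (formMatrix a)) :
    aeval x f ∈ degreeFiltration K deg 1 := by
  induction hf using Submodule.span_induction with
  | mem f hf =>
    obtain ⟨i, i', j, j', rfl⟩ := hf
    set A : Fin m → ι → HahnSeries Γ K := fun i j => ∑ q, a i j q • x ⟨j, q⟩ with hAdef
    have hA0 : ∀ i j, A i j ∈ degreeFiltration K deg 0 := fun i j =>
      Submodule.sum_mem _ fun q _ => Submodule.smul_mem _ _ (hx _)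
    have hT0 : ∀ i j, t j * w i ∈ degreeFiltration K deg 0 := fun i j => by
      have := Submodule.add_mem _ (degreeFiltration_anti zero_le_one (hA i j)) (hA0 i j)
      rwa [sub_add_cancel] at this
    have haev : ∀ i j, aeval x (formMatrix a i j) = A i j := fun i j => by
      simp [formMatrix, hAdef]
    rw [map_sub, map_mul, map_mul, haev, haev, haev, haev]
    have h1 : ∀ i j i' j', t j * w i * (t j' * w i') - A i j * A i' j' ∈
        degreeFiltration K deg 1 := fun i j i' j' => by
      have e : t j * w i * (t j' * w i') - A i j * A i' j' =
          (t j * w i - A i j) * (t j' * w i') + A i j * (t j' * w i' - A i' j') := by ring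
      rw [e]
      refine Submodule.add_mem _ ?_ ?_
      · simpa using mul_mem_degreeFiltration (hA i j) (hT0 i' j')
      · simpa using mul_mem_degreeFiltration (hA0 i j) (hA i' j')
    have e : A i j * A i' j' - A i' j * A i j' =
        (t j * w i' * (t j' * w i) - A i' j * A i j') -
          (t j * w i * (t j' * w i') - A i j * A i' j') := by ring
    rw [e]
    exact Submodule.sub_mem _ (h1 _ _ _ _) (h1 _ _ _ _)
  | zero => rw [map_zero]; exact Submodule.zero_mem _
  | add f g _ _ hf hg => rw [map_add]; exact Submodule.add_mem _ hf hg
  | smul r f _ hf =>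
    rw [smul_eq_mul, map_mul]
    simpa using mul_mem_degreeFiltration (aeval_mem_degreeFiltration hx r) hf

end Ideal

section Leads

variable {K ι : Type} [Field K] {E : ι → Type} [∀ j, Fintype (E j)] {m : ℕ}
  {p : ι → Prop} {τ : MonomialOrder (Σ j, E j)} {Γ : Type*}
  [AddCommGroup Γ] [LinearOrder Γ]

theorem TermWeight.exists_mem_twoMinors_of_mem_leads [Fintype (Subtype p)]
    (ω : TermWeight τ m Γ) (a : Fin m → ∀ j, E j → K) (c : ∀ j : Subtype p, E j)
    (hc : (fun j => Sum.inr (c j)) ∈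
      leads (fun c : ∀ j : Subtype p, Fin m ⊕ E j => ∑ j : Subtype p, ω.weight j (c j))
        (minorSpace fun i (j : Subtype p) => a i j)) :
    ∃ g ∈ twoMinors (formMatrix a),
      (∀ s ∈ g.support, ∃ x : ∀ j : Subtype p, E j, s = transversalExponent x) ∧
      transversalExponent c ∈ g.support ∧
      ∀ s ∈ g.support, τ.toSyn s ≤ τ.toSyn (transversalExponent c) := by
  classical
  obtain ⟨g, hg, hgc, hmax⟩ := hc
  set G : MvPolynomial (Σ j, E j) K := ∑ x : ∀ j : Subtype p, E j,
    g (fun j => Sum.inr (x j)) • ∏ j : Subtype p, X ⟨j, x j⟩ with hG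
  have hcoeff : ∀ s, coeff s G = ∑ x : ∀ j : Subtype p, E j,
      if transversalExponent x = s then g (fun j => Sum.inr (x j)) else 0 := fun s => by
    rw [hG, coeff_sum]
    refine Finset.sum_congr rfl fun x _ => ?_
    rw [smul_prod_X_eq_monomial, coeff_monomial]
  have hsupp : ∀ s ∈ G.support, ∃ x : ∀ j : Subtype p, E j,
      s = transversalExponent x ∧ g (fun j => Sum.inr (x j)) ≠ 0 := fun s hs => by
    rw [mem_support_iff, hcoeff] at hs
    obtain ⟨x, _, hx⟩ := Finset.exists_ne_zero_of_sum_ne_zero hs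
    have hxs : transversalExponent x = s := by
      by_contra h
      exact hx (if_neg h)
    exact ⟨x, hxs.symm, by rwa [if_pos hxs] at hx⟩
  refine ⟨G, sum_smul_prod_X_mem_twoMinors a hg,
    fun s hs => (hsupp s hs).imp fun _ h => h.1, ?_, fun s hs => ?_⟩
  · rw [mem_support_iff, hcoeff, Finset.sum_eq_single c]
    · rwa [if_pos rfl]
    · exact fun x _ hx => if_neg fun h => hx (transversalExponent_injective h)
    · exact fun h => absurd (Finset.mem_univ c) h
  · obtain ⟨x, rfl, hx⟩ := hsupp s hs
    by_contra h
    have := ω.lt_of_lt (transversalExponent c) (transversalExponent x)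
      (by rw [degree_transversalExponent, degree_transversalExponent]) (not_le.mp h)
    rw [sum_transversalExponent (fun y : Σ j, E j => ω.weight y.1 (Sum.inr y.2)),
      sum_transversalExponent (fun y : Σ j, E j => ω.weight y.1 (Sum.inr y.2))] at this
    exact hx (hmax _ this)

variable [IsOrderedAddMonoid Γ]

theorem TermWeight.not_isRealized_of_mem_twoMinors (ω : TermWeight τ m Γ)
    (a : Fin m → ∀ j, E j → K) {f : MvPolynomial (Σ j, E j) K}
    (hf : f ∈ twoMinors (formMatrix a)) {N : ℕ} (hN : ∀ s ∈ f.support, s.degree = N)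
    {u : (Σ j, E j) →₀ ℕ} (hu : u ∈ f.support) (hp : ∀ y, u y ≠ 0 → p y.1)
    (hmax : ∀ s ∈ f.support, τ.toSyn s ≤ τ.toSyn u)
    (S : ∀ j : Subtype p, Finset (Fin m ⊕ E j))
    (hS : ∀ (j : Subtype p) q, u ⟨j, q⟩ ≠ 0 → Sum.inr q ∈ S j) :
    ¬IsRealized (fun i (j : Subtype p) => a i j) (fun j => ω.weight j) S := by
  classical
  rintro ⟨w, v, ν, h⟩
  set t : ι → HahnSeries Γ K := fun j =>
    if hj : p j then HahnSeries.single (ω.unit - ν ⟨j, hj⟩) 1 else 0 with ht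
  set x : (Σ j, E j) → HahnSeries Γ K := fun y =>
    if hy : p y.1 then t y.1 * v ⟨y.1, hy⟩ y.2 else 0 with hx
  have hshift : ∀ (j : Subtype p) c, ω.unit - ω.weight j c =
      ω.unit - ν j + (ν j - ω.weight j c) := fun j c => by abel
  have hxv : ∀ (j : Subtype p) q, x ⟨j, q⟩ = HahnSeries.single (ω.unit - ν j) 1 *
      blockPoint (fun i (j : Subtype p) => a i j) w v j (Sum.inr q) := fun j q => by
    simp only [hx, ht, dif_pos j.2]
    rfl
  have hxvan : ∀ y, VanishesBelow (x y) (ω.unit - ω.weight y.1 (Sum.inr y.2)) := by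
    rintro ⟨j, q⟩
    by_cases hj : p j
    · have := ((h ⟨j, hj⟩ (Sum.inr q)).1).single_mul (ω.unit - ν ⟨j, hj⟩)
      rw [← hxv, ← hshift ⟨j, hj⟩] at this
      exact this
    · have : x ⟨j, q⟩ = 0 := dif_neg hj
      rw [this]
      exact VanishesBelow.zero _
  have hxcoeff : ∀ y, u y ≠ 0 → (x y).coeff (ω.unit - ω.weight y.1 (Sum.inr y.2)) ≠ 0 := by
    rintro ⟨j, q⟩ hy
    have hj : p j := hp _ hy
    have h1 := ((h ⟨j, hj⟩ (Sum.inr q)).1).coeff_single_mul (ω.unit - ν ⟨j, hj⟩)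
    rw [← hxv, ← hshift ⟨j, hj⟩] at h1
    simp only at h1 ⊢
    rw [h1]
    exact (h ⟨j, hj⟩ (Sum.inr q)).2 (hS ⟨j, hj⟩ q hy)
  have hx0 : ∀ y, x y ∈ degreeFiltration K ω.deg 0 := fun y => by
    have := (hxvan y).mem_degreeFiltration ω.monotone_deg
    rwa [map_sub, ω.deg_unit, ω.deg_inr, sub_self] at this
  have hA : ∀ i j, t j * w i - ∑ q, a i j q • x ⟨j, q⟩ ∈ degreeFiltration K ω.deg 1 := by
    intro i j
    by_cases hj : p j
    · have h1 := ((h ⟨j, hj⟩ (Sum.inl i)).1).single_mul (ω.unit - ν ⟨j, hj⟩)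
      rw [← hshift ⟨j, hj⟩] at h1
      have h2 := h1.mem_degreeFiltration ω.monotone_deg
      rw [map_sub, ω.deg_unit, ω.deg_inl, sub_zero] at h2
      have e : t j * w i - ∑ q, a i j q • x ⟨j, q⟩ = HahnSeries.single (ω.unit - ν ⟨j, hj⟩) 1 *
          blockPoint (fun i (j : Subtype p) => a i j) w v ⟨j, hj⟩ (Sum.inl i) := by
        simp only [hx, ht, dif_pos hj, blockPoint, Sum.elim_inl, mul_sub, Finset.mul_sum,
          Algebra.mul_smul_comm]
      rwa [e]
    · simp only [hx, ht, dif_neg hj, zero_mul, smul_zero, Finset.sum_const_zero, sub_zero]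
      exact Submodule.zero_mem _
  have hmem := mem_degreeFiltration_of_mem_twoMinors a hx0 t w hA hf
  have hprod : ∀ s ∈ f.support,
      VanishesBelow (∏ y ∈ s.support, x y ^ s y)
        (N • ω.unit - s.sum fun y k => k • ω.weight y.1 (Sum.inr y.2)) ∧
      (∏ y ∈ s.support, x y ^ s y).coeff
          (N • ω.unit - s.sum fun y k => k • ω.weight y.1 (Sum.inr y.2)) =
        ∏ y ∈ s.support, (x y).coeff (ω.unit - ω.weight y.1 (Sum.inr y.2)) ^ s y := by
    intro s hs
    have e : N • ω.unit - s.sum (fun y k => k • ω.weight y.1 (Sum.inr y.2)) =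
        ∑ y ∈ s.support, s y • (ω.unit - ω.weight y.1 (Sum.inr y.2)) := by
      simp only [smul_sub, Finset.sum_sub_distrib, ← Finset.sum_smul]
      rw [← hN s hs]
      rfl
    rw [e]
    have := VanishesBelow.prod s.support (x := fun y => x y ^ s y)
      fun y _ => ((hxvan y).pow (s y)).1
    refine ⟨this.1, this.2.trans (Finset.prod_congr rfl fun y _ => ((hxvan y).pow (s y)).2)⟩
  have hne := coeff_sum_smul_ne_zero f.support
    (fun s => s.sum fun y k => k • ω.weight y.1 (Sum.inr y.2))
    (fun s => ∏ y ∈ s.support, x y ^ s y) (N • ω.unit) (fun s hs => (hprod s hs).1) u hu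
    (by
      rw [(hprod u hu).2]
      exact Finset.prod_ne_zero_iff.mpr fun y hy =>
        pow_ne_zero _ (hxcoeff y (Finsupp.mem_support_iff.mp hy)))
    (fun s => coeff s f) (mem_support_iff.mp hu)
    (fun s hs hsu => Or.inr (ω.lt_of_lt s u ((hN s hs).trans (hN u hu).symm)
      (lt_of_le_of_ne (hmax s hs) (τ.toSyn.injective.ne hsu))))
  have heval : aeval x f = ∑ s ∈ f.support, coeff s f • ∏ y ∈ s.support, x y ^ s y := by
    rw [aeval_def, eval₂_eq]
    simp only [Algebra.smul_def]
  rw [← heval] at hne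
  have hle := hmem _ hne
  have hdeg : ω.deg (N • ω.unit - u.sum fun y k => k • ω.weight y.1 (Sum.inr y.2)) = 0 := by
    rw [map_sub, map_nsmul, ω.deg_unit, ← hN u hu, Finsupp.degree_apply, Finsupp.sum, map_sum]
    simp [ω.deg_inr]
  rw [hdeg] at hle
  exact absurd hle (by norm_num)

end Leads

/-- Every leading monomial of a multihomogeneous element of the ideal of `2`-minors is divisible
by the leading monomial of a multihomogeneous element of squarefree multidegree. -/
theorem exists_squarefree_multidegree_lead_le {K ι : Type} [Field K] [Infinite K] [Fintype ι]
    [LinearOrder ι] {E : ι → Type} [∀ j, Fintype (E j)] {m : ℕ}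
    (τ : MonomialOrder (Σ j, E j)) (a : Fin m → ∀ j, E j → K) {f : MvPolynomial (Σ j, E j) K}
    (hf : f ∈ twoMinors (formMatrix a)) {d : ι → ℕ}
    (hd : f.IsWeightedHomogeneous (fun y : Σ j, E j => (Pi.single y.1 1 : ι → ℕ)) d)
    {u : (Σ j, E j) →₀ ℕ} (hu : u ∈ f.support) (hmax : ∀ s ∈ f.support, τ.toSyn s ≤ τ.toSyn u) :
    ∃ g ∈ twoMinors (formMatrix a), (∃ b : ι → ℕ, (∀ j, b j ≤ 1) ∧
        g.IsWeightedHomogeneous (fun y : Σ j, E j => (Pi.single y.1 1 : ι → ℕ)) b) ∧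
      ∃ s ∈ g.support, s ≤ u ∧ ∀ t ∈ g.support, τ.toSyn t ≤ τ.toSyn s := by
  classical
  have hm : 0 < m := by
    rcases Nat.eq_zero_or_pos m with rfl | h
    · have hbot : twoMinors (formMatrix a) = ⊥ := by
        rw [twoMinors, Ideal.span_eq_bot]
        rintro _ ⟨i, _⟩
        exact i.elim0
      rw [hbot, Ideal.mem_bot] at hf
      simp [hf] at hu
    · exact h
  have hsum : ∀ s ∈ f.support, ∀ j, ∑ q, s ⟨j, q⟩ = d j := fun s hs j => by
    rw [← weight_single_fst_apply, hd (mem_support_iff.mp hs)]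
  obtain ⟨Γ, _, _, _, ⟨ω⟩⟩ := exists_termWeight τ m
  let p : ι → Prop := fun j => 0 < d j
  let S : ∀ j : Subtype p, Finset (Fin m ⊕ E j) := fun j =>
    (Finset.univ.filter fun q => u ⟨j, q⟩ ≠ 0).image Sum.inr
  have hS : ∀ j : Subtype p, (S j).Nonempty := by
    rintro ⟨j, hj⟩
    rw [Finset.image_nonempty]
    by_contra hemp
    rw [Finset.not_nonempty_iff_eq_empty, Finset.filter_eq_empty_iff] at hemp
    have h1 := hsum u hu j
    rw [Finset.sum_eq_zero fun q _ => not_not.mp (hemp (Finset.mem_univ q))] at h1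
    exact absurd h1 hj.ne
  rcases exists_mem_leads_or_isRealized hm (fun i (j : Subtype p) => a i j)
    (fun j => ω.weight j) (fun j => ω.weight_injective j) (ω.sum_weight_injective p) S hS with
    ⟨c, hcS, hc⟩ | hreal
  · have hcq : ∀ j : Subtype p, ∃ q, u ⟨j, q⟩ ≠ 0 ∧ Sum.inr q = c j := fun j => by
      simpa [S] using hcS j
    choose x hx hxc using hcq
    rw [← funext hxc] at hc
    obtain ⟨g, hg, hgs, hxg, hgmax⟩ := ω.exists_mem_twoMinors_of_mem_leads a x hc
    refine ⟨g, hg, ⟨fun j => if p j then 1 else 0, fun j => by dsimp only; split_ifs <;> simp, ?_⟩,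
      _, hxg, ?_, hgmax⟩
    · intro s hs
      obtain ⟨y, rfl⟩ := hgs s (mem_support_iff.mpr hs)
      funext j
      rw [weight_single_fst_apply]
      by_cases hj : p j
      · rw [if_pos hj]
        simp [transversalExponent_apply y ⟨j, hj⟩]
      · rw [if_neg hj]
        exact Finset.sum_eq_zero fun q _ => transversalExponent_apply_of_not y hj q
    · rintro ⟨j, q⟩
      by_cases hj : p j
      · have h1 := transversalExponent_apply x ⟨j, hj⟩ q
        rw [h1]
        split_ifs with hq
        · subst hq
          exact Nat.one_le_iff_ne_zero.mpr (hx ⟨j, hj⟩)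
        · exact Nat.zero_le _
      · rw [transversalExponent_apply_of_not x hj]
        exact Nat.zero_le _
  · refine absurd hreal (ω.not_isRealized_of_mem_twoMinors a hf (N := ∑ j, d j) ?_ hu ?_ hmax S ?_)
    · intro s hs
      rw [Finsupp.degree_eq_sum, Fintype.sum_sigma]
      exact Finset.sum_congr rfl fun j _ => hsum s hs j
    · rintro ⟨j, q⟩ hy
      change 0 < d j
      rw [← hsum u hu j]
      exact (Nat.pos_of_ne_zero hy).trans_le
        (Finset.single_le_sum (f := fun q => u ⟨j, q⟩) (fun _ _ => Nat.zero_le _)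
          (Finset.mem_univ q))
    · intro j q hq
      simpa [S] using hq

theorem twoMinors_transpose {R κ ι : Type} [CommRing R] (A : Matrix κ ι R) :
    twoMinors A.transpose = twoMinors A := by
  have h : ∀ {κ ι : Type} (A : Matrix κ ι R), twoMinors A.transpose ≤ twoMinors A := by
    intro κ ι A
    rw [twoMinors, Ideal.span_le]
    rintro _ ⟨i, i', j, j', rfl⟩
    refine Ideal.subset_span ⟨j, j', i, i', ?_⟩
    simp only [Matrix.transpose_apply]
    ring
  exact le_antisymm (h A) (h A.transpose)

theorem minorsIdeal_two_eq_twoMinors {R : Type} [CommRing R] {m N : ℕ}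
    (A : Matrix (Fin m) (Fin N) R) : minorsIdeal 2 A = twoMinors A := by
  refine le_antisymm (Ideal.span_le.mpr ?_) (Ideal.span_le.mpr ?_)
  · rintro _ ⟨r, c, _, _, rfl⟩
    refine Ideal.subset_span ⟨r 0, r 1, c 0, c 1, ?_⟩
    rw [Matrix.det_fin_two]
    simp only [Matrix.submatrix_apply]
    ring
  · rintro _ ⟨i, i', j, j', rfl⟩
    by_cases hi : i = i'
    · subst hi
      simp
    by_cases hj : j = j'
    · subst hj
      simp [mul_comm]
    have hinj : ∀ {n : ℕ} {x y : Fin n}, x ≠ y → Function.Injective ![x, y] := by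
      intro n x y hxy k l hkl
      fin_cases k <;> fin_cases l <;> simp_all
    refine Ideal.subset_span ⟨![i, i'], ![j, j'], hinj hi, hinj hj, ?_⟩
    rw [Matrix.det_fin_two]
    simp only [Matrix.submatrix_apply, Matrix.cons_val_zero, Matrix.cons_val_one]
    ring

theorem weightedHomogeneousComponent_mem_twoMinors {K κ ι σ M : Type} [Field K] [AddCommMonoid M]
    [DecidableEq M] (w : σ → M) (A : Matrix κ ι (MvPolynomial σ K)) (e : ι → M)
    (hA : ∀ i j, (A i j).IsWeightedHomogeneous w (e j)) {f : MvPolynomial σ K}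
    (hf : f ∈ twoMinors A) (d : M) : weightedHomogeneousComponent w d f ∈ twoMinors A := by
  let := weightedGradedAlgebra K w
  have h : (twoMinors A).IsHomogeneous (weightedHomogeneousSubmodule K w) := by
    refine Ideal.homogeneous_span _ _ ?_
    rintro _ ⟨i, i', j, j', rfl⟩
    exact ⟨e j + e j', Submodule.sub_mem _ ((hA i j).mul (hA i' j')) ((hA i' j).mul (hA i j'))⟩
  exact weightedHomogeneousComponent_mem_of_mem K w h hf d

section ColumnGraded

variable {K : Type} [Field K] {v m : ℕ} {n : Fin v → ℕ}

theorem exists_eq_formMatrix_of_columnGraded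
    {A : Matrix (Fin m) (Fin v) (MvPolynomial (MVar v n) K)}
    (hA : ColumnGraded A) :
    ∃ a : Fin m → ∀ j : Fin v, Fin (n j + 1) → K, A = formMatrix a := by
  classical
  obtain ⟨h, hA⟩ := hA
  refine ⟨fun i j q => coeff (Finsupp.single ⟨j, q⟩ 1) (A i j), ?_⟩
  ext i j s
  simp only [formMatrix, coeff_sum, coeff_smul, coeff_X, smul_eq_mul, mul_ite, mul_one, mul_zero]
  by_cases hs : ∃ q, s = Finsupp.single (⟨j, q⟩ : MVar v n) 1
  · obtain ⟨q, rfl⟩ := hs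
    rw [Finset.sum_eq_single q]
    · rw [if_pos rfl]
    · intro r _ hr
      refine if_neg fun h => hr ?_
      simpa using Finsupp.single_left_injective one_ne_zero h
    · exact fun h => absurd (Finset.mem_univ q) h
  · rw [Finset.sum_eq_zero fun q _ => if_neg fun h => hs ⟨q, h.symm⟩]
    by_contra hne
    rcases hA i j with h0 | h0
    · rw [h0, coeff_zero] at hne
      exact hne rfl
    · have hw : ∀ k, ∑ q, s ⟨k, q⟩ = (Pi.single j 1 : Fin v → ℕ) k := fun k =>
        (weight_single_fst_apply s k).symm.trans (congrFun (h0 hne) k)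
      have hdeg : s.sum (fun _ e => e) = 1 := by
        rw [Finsupp.sum_fintype _ _ fun _ => rfl, Fintype.sum_sigma]
        simp [hw]
      obtain ⟨⟨k, q⟩, rfl⟩ := (Finsupp.sum_eq_one_iff s).mp hdeg
      have hk := hw k
      have hjk : k = j := by
        by_contra hkj
        rw [Pi.single_eq_of_ne hkj, Finset.sum_eq_zero_iff] at hk
        simpa using hk q (Finset.mem_univ q)
      subst hjk
      exact hs ⟨q, rfl⟩

theorem formMatrix_isWeightedHomogeneous (a : Fin m → ∀ j : Fin v, Fin (n j + 1) → K) (i : Fin m)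
    (j : Fin v) : (formMatrix a i j).IsWeightedHomogeneous (wt v n) (Pi.single j 1) := by
  refine Submodule.sum_mem (weightedHomogeneousSubmodule K (wt v n) (Pi.single j 1)) fun q _ =>
    Submodule.smul_mem _ _ ?_
  exact isWeightedHomogeneous_X K (wt v n) ⟨j, q⟩

theorem leadExp_eq {τ : MonomialOrder (MVar v n)} {f : MvPolynomial (MVar v n) K}
    {u : MVar v n →₀ ℕ} (hu : u ∈ f.support) (hmax : ∀ s ∈ f.support, τ.toSyn s ≤ τ.toSyn u) :
    leadExp τ f = u := by
  rw [leadExp, AddEquiv.symm_apply_eq]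
  exact le_antisymm (Finset.sup_le hmax) (Finset.le_sup (f := τ.toSyn) hu)

theorem exists_leadExp (τ : MonomialOrder (MVar v n)) {f : MvPolynomial (MVar v n) K}
    (hf : f ≠ 0) :
    leadExp τ f ∈ f.support ∧ ∀ s ∈ f.support, τ.toSyn s ≤ τ.toSyn (leadExp τ f) := by
  obtain ⟨u, hu, hmax⟩ := Finset.exists_max_image f.support τ.toSyn (support_nonempty.mpr hf)
  rw [leadExp_eq hu hmax]
  exact ⟨hu, hmax⟩

theorem exists_universal_groebner_basis_of_columnGraded [Infinite K]
    {A : Matrix (Fin m) (Fin v) (MvPolynomial (MVar v n) K)} (hA : ColumnGraded A) :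
    ∃ G : Set (MvPolynomial (MVar v n) K),
      (∀ f ∈ G, ∃ a : Fin v → ℕ, (∀ k, a k ≤ 1) ∧ f.IsWeightedHomogeneous (wt v n) a) ∧
      ∀ τ : MonomialOrder (MVar v n), IsGroebnerBasis τ G (twoMinors A) := by
  classical
  obtain ⟨a, rfl⟩ := exists_eq_formMatrix_of_columnGraded hA
  refine ⟨{f | f ∈ twoMinors (formMatrix a) ∧ ∃ b : Fin v → ℕ, (∀ k, b k ≤ 1) ∧
    f.IsWeightedHomogeneous (wt v n) b}, fun f hf => hf.2, fun τ => ⟨fun f hf => hf.1, ?_⟩⟩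
  refine le_antisymm (Ideal.span_mono ?_) (Ideal.span_le.mpr ?_)
  · rintro _ ⟨f, ⟨hf, hf0⟩, rfl⟩
    exact ⟨f, hf.1, hf0, rfl⟩
  · rintro _ ⟨f, hf, hf0, rfl⟩
    obtain ⟨hu, hmax⟩ := exists_leadExp τ hf0
    set u := leadExp τ f with hudef
    set d := Finsupp.weight (wt v n) u with hd
    have hcomp := weightedHomogeneousComponent_mem_twoMinors (wt v n) (formMatrix a) _
      (formMatrix_isWeightedHomogeneous a) hf d
    have hcoeff : ∀ s, coeff s (weightedHomogeneousComponent (wt v n) d f) =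
        if Finsupp.weight (wt v n) s = d then coeff s f else 0 := fun s =>
      coeff_weightedHomogeneousComponent d f s
    obtain ⟨g, hg, hb, s, hs, hsu, hsmax⟩ := exists_squarefree_multidegree_lead_le τ a hcomp
      (weightedHomogeneousComponent_isWeightedHomogeneous d f) (u := u)
      (by
        rw [mem_support_iff, hcoeff, if_pos rfl]
        exact mem_support_iff.mp hu)
      (fun t ht => hmax t (by
        rw [mem_support_iff, hcoeff] at ht
        rw [mem_support_iff]
        exact fun h => ht (by rw [h, ite_self])))
    have hmon : (monomial u (1 : K)) = monomial (u - s) 1 * monomial s 1 := by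
      rw [monomial_mul, one_mul, tsub_add_cancel_of_le hsu]
    rw [SetLike.mem_coe, hmon]
    refine Ideal.mul_mem_left _ _ (Ideal.subset_span ⟨g, ⟨⟨hg, hb⟩, ?_⟩, ?_⟩)
    · rintro rfl
      simp at hs
    · simp only [leadExp_eq hs hsmax]

end ColumnGraded

/-- **Main Theorem (4).** In the column-graded case (`v = n`), `I_2(A)` has a universal
Gröbner basis of multihomogeneous elements of multidegree at most `e_1 + ⋯ + e_n`; in the
row-graded case (`v = m`), `I_2(A)` has a universal Gröbner basis of multihomogeneous
elements of multidegree at most `e_1 + ⋯ + e_m`. -/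
theorem two_minors_universal_groebner_basis (K : Type) [Field K] [Infinite K] :
    (∀ (m N : ℕ) (n : Fin N → ℕ)
      (A : Matrix (Fin m) (Fin N) (MvPolynomial (MVar N n) K)), m ≤ N →
      ColumnGraded A →
      ∃ G : Set (MvPolynomial (MVar N n) K),
        (∀ f ∈ G, ∃ a : Fin N → ℕ, (∀ k, a k ≤ 1) ∧
          f.IsWeightedHomogeneous (wt N n) a) ∧
        ∀ τ : MonomialOrder (MVar N n), IsGroebnerBasis τ G (minorsIdeal 2 A)) ∧
    (∀ (m N : ℕ) (n : Fin m → ℕ)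
      (A : Matrix (Fin m) (Fin N) (MvPolynomial (MVar m n) K)), m ≤ N →
      RowGraded A →
      ∃ G : Set (MvPolynomial (MVar m n) K),
        (∀ f ∈ G, ∃ a : Fin m → ℕ, (∀ k, a k ≤ 1) ∧
          f.IsWeightedHomogeneous (wt m n) a) ∧
        ∀ τ : MonomialOrder (MVar m n), IsGroebnerBasis τ G (minorsIdeal 2 A)) := by
  refine ⟨fun m N n A _ hA => ?_, fun m N n A _ hA => ?_⟩
  · rw [minorsIdeal_two_eq_twoMinors]
    exact exists_universal_groebner_basis_of_columnGraded hA
  · rw [minorsIdeal_two_eq_twoMinors, ← twoMinors_transpose]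
    obtain ⟨h, hA⟩ := hA
    exact exists_universal_groebner_basis_of_columnGraded (A := A.transpose)
      ⟨h, fun i j => hA j i⟩

end
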